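/- Let 1<p<∞ and let w be a weight on ℝⁿ with w ∈ A_p^{+(s)}(ℝⁿ) (equivalently w ∈ A_p^+(x_i) for each i). Then there exists a constant c depending only on n and p such that the one-sided strong maximal operator M^{+(s)} satisfies ‖M^{+(s)}f‖_{L^p_w(ℝⁿ)} ≤ c (∏_{i=1}^n ‖w‖_{A_p^+(x_i)})^{1/(p-1)} ‖f‖_{L^p_w(ℝⁿ)} for all f ∈ L^p_w(ℝⁿ). Moreover the power 1/(p-1) is sharp: for n = 2, w(x₁,x₂) = |1−x₁|^{(1-ε)(p-1)}|1−x₂|^{(1-ε)(p-1)} with ε ∈ (0,1) satisfies (‖w‖_{A_p^+(x_1)}‖w‖_{A_p^+(x_2)})^{1/(p-1)} ≍ ε^{-2}, and there exists f ∈ L^p_w with ‖M^{+(s)}f‖_{L^p_w(ℝ²)} ≥ c ε^{-2} ‖f‖_{L^p_w}. -/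

import Mathlib

open MeasureTheory Set Filter
open scoped ENNReal

noncomputable section

/-- `∫_a^b w` as a lower integral. -/
def lintIoc (w : ℝ → ℝ) (a b : ℝ) : ℝ≥0∞ :=
  ∫⁻ t in Set.Ioc a b, ENNReal.ofReal (w t)

/-- Average `(1/(b-a)) ∫_a^b w`. -/
def avgIoc (w : ℝ → ℝ) (a b : ℝ) : ℝ≥0∞ :=
  (ENNReal.ofReal (b - a))⁻¹ * lintIoc w a b

/-- The one-sided Muckenhoupt `A_p^+` characteristic of a function of one variable:
`sup_{x,h>0} ((1/h)∫_{x-h}^x u)((1/h)∫_x^{x+h} u^{-1/(p-1)})^{p-1}`. -/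
def apPlusChar (p : ℝ) (u : ℝ → ℝ) : ℝ≥0∞ :=
  ⨆ (x : ℝ) (h : ℝ) (_ : 0 < h),
    avgIoc u (x - h) x *
      avgIoc (fun t => u t ^ (-(1 / (p - 1)))) x (x + h) ^ (p - 1)

/-- `A_p^+` characteristic of `w : ℝⁿ → ℝ` in the `i`-th variable, uniformly
(essential supremum) with respect to the remaining variables. -/
def apPlusVar {n : ℕ} (p : ℝ) (w : (Fin n → ℝ) → ℝ) (i : Fin n) : ℝ≥0∞ :=
  essSup (fun x : Fin n → ℝ => apPlusChar p (fun t => w (Function.update x i t)))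
    MeasureTheory.volume

/-- A weight on `ℝⁿ`: a.e. positive and locally integrable. -/
def IsWeightN {n : ℕ} (w : (Fin n → ℝ) → ℝ) : Prop :=
  (∀ᵐ x : Fin n → ℝ, 0 < w x) ∧ MeasureTheory.LocallyIntegrable w MeasureTheory.volume

/-- Weighted `L^p(ℝⁿ)` "norm" `(∫ g^p w)^{1/p}` of an `ℝ≥0∞`-valued function. -/
def lnormWN {n : ℕ} (p : ℝ) (w : (Fin n → ℝ) → ℝ) (g : (Fin n → ℝ) → ℝ≥0∞) : ℝ≥0∞ :=
  (∫⁻ x : Fin n → ℝ, g x ^ p * ENNReal.ofReal (w x)) ^ (1 / p)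

/-- The one-sided strong maximal operator on `ℝⁿ`:
`M^{+(s)}f(x) = sup_{h₁,…,hₙ>0} (∏ᵢhᵢ)⁻¹ ∫_{x₁}^{x₁+h₁}⋯∫_{xₙ}^{xₙ+hₙ} |f|`. -/
def MsPlus {n : ℕ} (f : (Fin n → ℝ) → ℝ) (x : Fin n → ℝ) : ℝ≥0∞ :=
  ⨆ (h : Fin n → ℝ) (_ : ∀ i, 0 < h i),
    (∏ i, ENNReal.ofReal (h i))⁻¹ *
      ∫⁻ y in Set.univ.pi (fun i => Set.Ioc (x i) (x i + h i)), ENNReal.ofReal |f y|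

noncomputable section

def Mx (μ : Measure ℝ) (φ : ℝ → ℝ≥0∞) (x : ℝ) : ℝ≥0∞ :=
  ⨆ (b : ℝ) (_ : x < b), (∫⁻ t in Ioo x b, φ t ∂μ) / μ (Ioo x b)

lemma lint_le_Mx (μ : Measure ℝ) [IsLocallyFiniteMeasure μ] (φ : ℝ → ℝ≥0∞) {x b : ℝ} (h : x < b) :
    ∫⁻ t in Ioo x b, φ t ∂μ ≤ Mx μ φ x * μ (Ioo x b) := by
  by_cases h0 : μ (Ioo x b) = 0
  · rw [setLIntegral_measure_zero _ _ h0]; exact zero_le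
  · have h1 : μ (Ioo x b) ≠ ∞ := measure_Ioo_lt_top.ne
    rw [← ENNReal.div_le_iff h0 h1]
    exact le_iSup₂ (f := fun (b : ℝ) (_ : x < b) => (∫⁻ t in Ioo x b, φ t ∂μ) / μ (Ioo x b)) b h

lemma lint_Ioo_rat (μ : Measure ℝ) (φ : ℝ → ℝ≥0∞) (x b : ℝ) :
    ∫⁻ t in Ioo x b, φ t ∂μ = ⨆ q : {q : ℚ // (q : ℝ) < b}, ∫⁻ t in Ioo x (q : ℝ), φ t ∂μ := by
  rw [← setLIntegral_iUnion_of_directed]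
  · congr 2
    ext t
    simp only [mem_Ioo, mem_iUnion, Subtype.exists, exists_prop]
    constructor
    · rintro ⟨h1, h2⟩
      obtain ⟨q, hq1, hq2⟩ := exists_rat_btwn h2
      exact ⟨q, hq2, h1, hq1⟩
    · rintro ⟨q, h1, h2, h3⟩
      exact ⟨h2, h3.trans h1⟩
  · intro q r
    rcases le_total q.1 r.1 with h | h
    · exact ⟨r, Ioo_subset_Ioo_right (by exact_mod_cast h), subset_rfl⟩
    · exact ⟨q, subset_rfl, Ioo_subset_Ioo_right (by exact_mod_cast h)⟩

lemma Mx_rat (μ : Measure ℝ) (φ : ℝ → ℝ≥0∞) (x : ℝ) :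
    Mx μ φ x = ⨆ q : ℚ, (∫⁻ t in Ioo x q, φ t ∂μ) / μ (Ioo x q) := by
  apply le_antisymm
  · refine iSup₂_le fun b hb => ?_
    rw [lint_Ioo_rat, ENNReal.iSup_div]
    refine iSup_le fun q => ?_
    refine le_trans ?_ (le_iSup _ q.1)
    gcongr
    exact q.2.le
  · refine iSup_le fun q => ?_
    by_cases h : x < q
    · exact le_iSup₂ (f := fun (b : ℝ) (_ : x < b) => (∫⁻ t in Ioo x b, φ t ∂μ) / μ (Ioo x b)) (q : ℝ) h
    · rw [Ioo_eq_empty h]; simp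

lemma measurable_Mx (μ : Measure ℝ) (φ : ℝ → ℝ≥0∞) : Measurable (Mx μ φ) := by
  have : Mx μ φ = fun x => ⨆ q : ℚ, (∫⁻ t in Ioo x q, φ t ∂μ) / μ (Ioo x q) := by
    funext x; exact Mx_rat μ φ x
  rw [this]
  refine Measurable.iSup fun q => Measurable.div ?_ ?_
  · apply Antitone.measurable
    intro a b hab
    exact lintegral_mono_set (Ioo_subset_Ioo_left hab)
  · apply Antitone.measurable
    intro a b hab
    exact measure_mono (Ioo_subset_Ioo_left hab)

/-- greedy selection -/
lemma greedy (μ ν : Measure ℝ) (c : ℝ≥0∞) (t : ℕ → ℝ) (ht : Monotone t) (N : ℕ) (O : Set ℝ)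
    (hO : ∀ y ∈ O, ∀ i < N, y ∈ Ioc (t i) (t (i+1)) →
      ∃ j, i < j ∧ j ≤ N ∧ c * μ (Ioc (t i) (t j)) ≤ ν (Ioc (t i) (t j))) :
    ∀ k i, i + k = N → c * μ (O ∩ Ioc (t i) (t N)) ≤ ν (Ioc (t i) (t N)) := by
  intro k
  induction k using Nat.strong_induction_on with
  | _ k ih =>
    intro i hi
    by_cases hk : k = 0
    · have : i = N := by omega
      subst this; simp
    by_cases hg : ∃ j, i < j ∧ j ≤ N ∧ c * μ (Ioc (t i) (t j)) ≤ ν (Ioc (t i) (t j))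
    · obtain ⟨j, h1, h2, h3⟩ := hg
      have h4 := ih (N - j) (by omega) j (by omega)
      have hsplit : Ioc (t i) (t N) = Ioc (t i) (t j) ∪ Ioc (t j) (t N) :=
        (Ioc_union_Ioc_eq_Ioc (ht h1.le) (ht h2)).symm
      calc c * μ (O ∩ Ioc (t i) (t N)) ≤ c * (μ (Ioc (t i) (t j)) + μ (O ∩ Ioc (t j) (t N))) := by
            gcongr
            refine le_trans (measure_mono ?_) (measure_union_le _ _)
            rw [hsplit, inter_union_distrib_left]
            exact union_subset_union_left _ inter_subset_right
        _ ≤ ν (Ioc (t i) (t j)) + ν (Ioc (t j) (t N)) := by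
            rw [mul_add]; exact add_le_add h3 h4
        _ = ν (Ioc (t i) (t N)) := by
            rw [hsplit, measure_union (Ioc_disjoint_Ioc_of_le le_rfl) measurableSet_Ioc]
    · have h4 := ih (k - 1) (by omega) (i+1) (by omega)
      refine le_trans ?_ (h4.trans (measure_mono (Ioc_subset_Ioc_left (ht (by omega)))))
      gcongr c * μ ?_
      rintro y ⟨hy, hy1, hy2⟩
      refine ⟨hy, ?_, hy2⟩
      by_contra hcon
      exact hg (hO y hy i (by omega) ⟨hy1, not_lt.1 hcon⟩)

lemma weak_type (μ : Measure ℝ) [IsLocallyFiniteMeasure μ] [NullSingletonClass μ]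
    (φ : ℝ → ℝ≥0∞) (c : ℝ≥0∞) : c * μ {x | c < Mx μ φ x} ≤ ∫⁻ t, φ t ∂μ := by
  by_cases hc0 : c = 0
  · simp [hc0]
  by_cases hct : c = ∞
  · simp [hct]
  set ν := μ.withDensity φ with hν
  have hνI : ∀ x b, ν (Ioo x b) = ∫⁻ t in Ioo x b, φ t ∂μ := fun x b =>
    withDensity_apply _ measurableSet_Ioo
  have hνu : ν univ = ∫⁻ t, φ t ∂μ := by rw [hν, withDensity_apply _ MeasurableSet.univ]; simp
  set t : ℕ → ℕ → ℝ := fun k i => -(k:ℝ) + i / ((k:ℝ)+1) with ht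
  have htm : ∀ k, Monotone (t k) := by
    intro k i j hij
    simp only [ht]
    gcongr
  set N : ℕ → ℕ := fun k => 2 * k * (k+1) with hN
  have htN : ∀ k, t k (N k) = k := by
    intro k
    simp only [ht, hN]; push_cast
    field_simp; ring
  have ht0 : ∀ k, t k 0 = -k := by intro k; simp [ht]
  set O : ℕ → Set ℝ := fun k => {y | ∀ i < N k, y ∈ Ioc (t k i) (t k (i+1)) →
      ∃ j, i < j ∧ j ≤ N k ∧ c * μ (Ioc (t k i) (t k j)) ≤ ν (Ioc (t k i) (t k j))} with hO
  have key : ∀ k, c * μ (O k ∩ Ioc (-(k:ℝ)) k) ≤ ν univ := by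
    intro k
    have := greedy μ ν c (t k) (htm k) (N k) (O k) (fun y hy => hy) (N k) 0 (by omega)
    rw [ht0, htN] at this
    exact this.trans (measure_mono (subset_univ _))
  have ev : ∀ x, c < Mx μ φ x → ∃ K, ∀ k ≥ K, x ∈ O k ∩ Ioc (-(k:ℝ)) k := by
    intro x hx
    obtain ⟨b, hb⟩ := lt_iSup_iff.1 hx
    obtain ⟨hxb, hb⟩ := lt_iSup_iff.1 hb
    rw [← hνI] at hb
    have h1 : μ (Ioo x b) ≠ ∞ := measure_Ioo_lt_top.ne
    have h0 : μ (Ioo x b) ≠ 0 := by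
      intro h0
      have : ν (Ioo x b) = 0 := withDensity_absolutelyContinuous _ _ h0
      rw [this] at hb; simp at hb
    rw [ENNReal.lt_div_iff_mul_lt (Or.inl h0) (Or.inl h1), mul_comm,
      ← ENNReal.lt_div_iff_mul_lt (Or.inl hc0) (Or.inl hct)] at hb
    rw [measure_congr (Ioo_ae_eq_Icc (μ := μ))] at hb
    obtain ⟨U, hU, hUo, hUm⟩ := Set.exists_isOpen_lt_of_lt _ _ hb
    obtain ⟨e1, he1, hb1⟩ := Metric.isOpen_iff.1 hUo x (hU (left_mem_Icc.2 hxb.le))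
    obtain ⟨e2, he2, hb2⟩ := Metric.isOpen_iff.1 hUo b (hU (right_mem_Icc.2 hxb.le))
    set η := min e1 e2
    have hη : 0 < η := lt_min he1 he2
    have hsub : Ioo (x - η) (b + η) ⊆ U := by
      intro y hy
      rcases lt_or_ge y x with h | h
      · apply hb1; rw [Metric.mem_ball, Real.dist_eq, abs_lt]
        have := min_le_left e1 e2
        constructor <;> linarith [hy.1]
      rcases le_or_gt y b with h' | h'
      · exact hU ⟨h, h'⟩
      · apply hb2; rw [Metric.mem_ball, Real.dist_eq, abs_lt]
        have := min_le_right e1 e2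
        constructor <;> linarith [hy.2]
    obtain ⟨K1, hK1⟩ := exists_nat_gt (1/η)
    obtain ⟨K2, hK2⟩ := exists_nat_gt (|x| + |b| + η)
    refine ⟨max K1 K2, fun k hk => ?_⟩
    have hk1 : (K1:ℝ) ≤ k := by exact_mod_cast (le_max_left _ _).trans hk
    have hk2 : (K2:ℝ) ≤ k := by exact_mod_cast (le_max_right _ _).trans hk
    have hkp : (0:ℝ) < (k:ℝ)+1 := by positivity
    have hδ : 1 / ((k:ℝ)+1) < η := by
      rw [div_lt_iff₀ hkp]; rw [div_lt_iff₀ hη] at hK1; nlinarith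
    have hx1 := abs_le.1 (le_refl |x|)
    have hb1 := abs_le.1 (le_refl |b|)
    refine ⟨?_, by constructor <;> linarith [abs_nonneg b, abs_nonneg x]⟩
    intro i hi hxi
    have hbk : 0 < b + k := by linarith [abs_nonneg b, abs_nonneg x]
    set j := ⌈(b + k) * (k+1)⌉₊ with hj
    have hj1 : b ≤ t k j := by
      have := Nat.le_ceil ((b + k) * ((k:ℝ)+1))
      have : b + k ≤ j / ((k:ℝ)+1) := by rw [le_div_iff₀ hkp]; exact this
      simp only [ht]; linarith
    have hj2 : t k j < b + η := by
      have := Nat.ceil_lt_add_one (a := (b + k) * ((k:ℝ)+1)) (by positivity)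
      have : j / ((k:ℝ)+1) < b + k + 1 / ((k:ℝ)+1) := by
        rw [div_lt_iff₀ hkp, add_mul, div_mul_cancel₀ _ hkp.ne']; exact this
      simp only [ht]; linarith
    have hij : i < j := by
      by_contra hcon
      have := htm k (not_lt.1 hcon)
      linarith [hxi.1]
    have hjN : j ≤ N k := by
      by_contra hcon
      have h3 : t k (N k) ≤ t k j := htm k (not_le.1 hcon).le
      rw [htN] at h3
      linarith [abs_nonneg b, abs_nonneg x]
    have hti : x - η < t k i := by
      have h4 : t k (i+1) = t k i + 1 / ((k:ℝ)+1) := by simp only [ht]; push_cast; ring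
      linarith [hxi.2]
    refine ⟨j, hij, hjN, ?_⟩
    have h5 : μ (Ioc (t k i) (t k j)) ≤ ν (Ioo x b) / c := by
      refine (measure_mono ?_).trans hUm.le
      refine Subset.trans ?_ hsub
      intro y hy; exact ⟨hti.trans hy.1, hy.2.trans_lt hj2⟩
    rw [ENNReal.le_div_iff_mul_le (Or.inl hc0) (Or.inl hct), mul_comm] at h5
    refine h5.trans (measure_mono ?_)
    intro y hy; exact ⟨hxi.1.trans hy.1, hy.2.le.trans hj1⟩
  have hsub : {x | c < Mx μ φ x} ⊆ ⋃ K : ℕ, ⋂ k ≥ K, (O k ∩ Ioc (-(k:ℝ)) k) := by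
    intro x hx
    obtain ⟨K, hK⟩ := ev x hx
    exact mem_iUnion.2 ⟨K, mem_iInter₂.2 hK⟩
  have hmono : Monotone fun K : ℕ => ⋂ k ≥ K, (O k ∩ Ioc (-(k:ℝ)) k) := by
    intro a b hab
    exact biInter_subset_biInter_left (fun k hk => le_trans hab hk)
  calc c * μ {x | c < Mx μ φ x} ≤ c * μ (⋃ K : ℕ, ⋂ k ≥ K, (O k ∩ Ioc (-(k:ℝ)) k)) := by gcongr
    _ = ⨆ K : ℕ, c * μ (⋂ k ≥ K, (O k ∩ Ioc (-(k:ℝ)) k)) := by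
        rw [hmono.measure_iUnion, ENNReal.mul_iSup]
    _ ≤ ν univ := by
        refine iSup_le fun K => le_trans ?_ (key K)
        gcongr
        exact biInter_subset_of_mem (t := fun k => O k ∩ Ioc (-(k:ℝ)) k) (le_refl K)
    _ = _ := hνu

lemma layer (s : ℝ) (hs : 0 < s) (a : ℝ≥0∞) :
    ENNReal.ofReal s * ∫⁻ t in Ioi (0:ℝ), (if ENNReal.ofReal t < a then ENNReal.ofReal (t ^ (s-1)) else 0)
      = a ^ s := by
  have fin : ∀ r : ℝ, 0 < r → ENNReal.ofReal s * ∫⁻ t in Ioo (0:ℝ) r, ENNReal.ofReal (t ^ (s-1)) = ENNReal.ofReal (r ^ s) := by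
    intro r hr
    rw [← ofReal_integral_eq_lintegral_ofReal, ← integral_Ioc_eq_integral_Ioo,
      ← intervalIntegral.integral_of_le hr.le, integral_rpow (Or.inl (by linarith)),
      ← ENNReal.ofReal_mul hs.le]
    · congr 1
      rw [sub_add_cancel, Real.zero_rpow hs.ne', sub_zero]; field_simp
    · exact (intervalIntegral.integrableOn_Ioo_rpow_iff hr).2 (by linarith)
    · filter_upwards [ae_restrict_mem measurableSet_Ioo] with t ht
      exact Real.rpow_nonneg ht.1.le _
  rcases eq_or_ne a ∞ with rfl | ha
  · simp only [ENNReal.ofReal_lt_top, if_true, ENNReal.top_rpow_of_pos hs]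
    apply ENNReal.eq_top_of_forall_nnreal_le
    intro r
    have h1 : (0:ℝ) < (r + 1 : ℝ) ^ (1/s) := by positivity
    have := fin _ h1
    rw [← Real.rpow_mul (by positivity), one_div_mul_cancel hs.ne', Real.rpow_one] at this
    calc (r:ℝ≥0∞) ≤ ENNReal.ofReal (r + 1) := by
          rw [← ENNReal.ofReal_coe_nnreal]; exact ENNReal.ofReal_le_ofReal (by linarith)
      _ = _ := this.symm
      _ ≤ _ := by
        gcongr
        exact Ioo_subset_Ioi_self
  · lift a to NNReal using ha
    rcases eq_or_ne a 0 with rfl | h0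
    · simp [ENNReal.zero_rpow_of_pos hs]
    have hpos : (0:ℝ) < a := by positivity
    have h1 : ((a:ℝ≥0∞)) ^ s = ENNReal.ofReal ((a:ℝ)^s) := by
      rw [← ENNReal.ofReal_rpow_of_pos hpos, ENNReal.ofReal_coe_nnreal]
    rw [h1, ← fin a hpos]
    congr 1
    rw [← lintegral_indicator measurableSet_Ioi, ← lintegral_indicator measurableSet_Ioo]
    congr 1; funext t
    simp only [indicator, mem_Ioi, mem_Ioo]
    by_cases h : 0 < t
    · simp only [h, if_true, true_and]
      have : ENNReal.ofReal t < a ↔ t < a := by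
        rw [← ENNReal.ofReal_coe_nnreal, ENNReal.ofReal_lt_ofReal_iff hpos]
      simp only [this]
    · simp [h]

lemma strong_type (q : ℝ) (hq : 1 < q) (μ : Measure ℝ) [IsLocallyFiniteMeasure μ]
    [NullSingletonClass μ] (φ : ℝ → ℝ≥0∞) (hφ : Measurable φ) :
    ∫⁻ x, (Mx μ φ x) ^ q ∂μ ≤ ENNReal.ofReal (2 ^ q * (q / (q-1))) * ∫⁻ x, (φ x) ^ q ∂μ := by
  have hM := measurable_Mx μ φ
  have red : ∀ c : ℝ≥0∞, c * μ {x | c < Mx μ φ x} ≤ 2 * ∫⁻ x, (if c < 2 * φ x then φ x else 0) ∂μ := by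
    intro c
    have hsub : {x | c < Mx μ φ x} ⊆ {x | c / 2 < Mx μ (fun x => if c < 2 * φ x then φ x else 0) x} := by
      intro x hx
      rw [mem_ofPred_eq] at hx ⊢
      by_contra hcon
      rw [not_lt] at hcon
      refine hx.not_ge ?_
      refine iSup₂_le fun b hb => ?_
      have h1 : (∫⁻ t in Ioo x b, φ t ∂μ) ≤ c / 2 * μ (Ioo x b) + c / 2 * μ (Ioo x b) := by
        calc ∫⁻ t in Ioo x b, φ t ∂μ ≤ ∫⁻ t in Ioo x b, ((if c < 2 * φ t then φ t else 0) + c / 2) ∂μ := by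
              refine lintegral_mono fun t => ?_
              split_ifs with h
              · exact le_self_add
              · rw [zero_add, ENNReal.le_div_iff_mul_le (by simp) (by simp), mul_comm]
                exact not_lt.1 h
          _ ≤ _ := by
              rw [lintegral_add_right _ measurable_const]
              gcongr
              · exact (lint_le_Mx μ _ hb).trans (by gcongr)
              · simp
      rw [← add_mul, ENNReal.add_halves] at h1
      exact ENNReal.div_le_of_le_mul h1
    calc c * μ {x | c < Mx μ φ x} = 2 * (c / 2 * μ {x | c < Mx μ φ x}) := by
          rw [← mul_assoc, ENNReal.mul_div_cancel (by simp) (by simp)]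
      _ ≤ 2 * (c / 2 * μ {x | c / 2 < Mx μ (fun x => if c < 2 * φ x then φ x else 0) x}) := by
          gcongr
      _ ≤ _ := by gcongr; exact weak_type μ _ _
  have hq0 : 0 < q := by linarith
  have hmo : Measurable (fun z : ℝ × ℝ => ENNReal.ofReal z.2) := by fun_prop
  calc ∫⁻ x, (Mx μ φ x) ^ q ∂μ
      = ∫⁻ x, ENNReal.ofReal q * (∫⁻ t in Ioi (0:ℝ), (if ENNReal.ofReal t < Mx μ φ x then ENNReal.ofReal (t ^ (q-1)) else 0)) ∂μ := by
        congr 1; funext x; rw [layer q hq0]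
    _ = ENNReal.ofReal q * ∫⁻ x, (∫⁻ t in Ioi (0:ℝ), (if ENNReal.ofReal t < Mx μ φ x then ENNReal.ofReal (t ^ (q-1)) else 0)) ∂μ := by
        rw [lintegral_const_mul' _ _ ENNReal.ofReal_ne_top]
    _ = ENNReal.ofReal q * ∫⁻ t in Ioi (0:ℝ), ∫⁻ x, (if ENNReal.ofReal t < Mx μ φ x then ENNReal.ofReal (t ^ (q-1)) else 0) ∂μ := by
        rw [lintegral_lintegral_swap]
        refine Measurable.aemeasurable ?_
        refine Measurable.ite (measurableSet_lt hmo (hM.comp measurable_fst)) (by fun_prop) measurable_const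
    _ ≤ ENNReal.ofReal q * ∫⁻ t in Ioi (0:ℝ), 2 * ∫⁻ x, φ x * (if ENNReal.ofReal t < 2 * φ x then ENNReal.ofReal (t ^ (q-1-1)) else 0) ∂μ := by
        gcongr ENNReal.ofReal q * ?_
        refine setLIntegral_mono' measurableSet_Ioi fun t ht => ?_
        have ht : 0 < t := ht
        calc ∫⁻ x, (if ENNReal.ofReal t < Mx μ φ x then ENNReal.ofReal (t ^ (q-1)) else 0) ∂μ
            = ENNReal.ofReal (t ^ (q-1)) * μ {x | ENNReal.ofReal t < Mx μ φ x} := by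
              rw [← lintegral_indicator_const (measurableSet_lt measurable_const hM)]
              simp only [indicator, mem_ofPred_eq]
          _ = ENNReal.ofReal (t ^ (q-1-1)) * (ENNReal.ofReal t * μ {x | ENNReal.ofReal t < Mx μ φ x}) := by
              rw [← mul_assoc, ← ENNReal.ofReal_mul (by positivity)]
              congr 2
              rw [← Real.rpow_add_one ht.ne']; ring_nf
          _ ≤ ENNReal.ofReal (t ^ (q-1-1)) * (2 * ∫⁻ x, (if ENNReal.ofReal t < 2 * φ x then φ x else 0) ∂μ) := by
              exact mul_le_mul_right (red _) _
          _ = _ := by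
              rw [mul_left_comm, ← lintegral_const_mul' _ _ ENNReal.ofReal_ne_top]
              congr 2; funext x
              split_ifs <;> simp [mul_comm]
    _ = ENNReal.ofReal q * (2 * ∫⁻ x, φ x * (∫⁻ t in Ioi (0:ℝ), (if ENNReal.ofReal t < 2 * φ x then ENNReal.ofReal (t ^ (q-1-1)) else 0)) ∂μ) := by
        rw [lintegral_const_mul' _ _ (by simp), lintegral_lintegral_swap]
        · congr 3; funext x
          rw [lintegral_const_mul]
          exact Measurable.ite (measurableSet_lt (by fun_prop) measurable_const) (by fun_prop) measurable_const
        · refine Measurable.aemeasurable ?_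
          refine Measurable.mul (hφ.comp measurable_snd) ?_
          exact Measurable.ite (measurableSet_lt (by fun_prop) (by fun_prop)) (by fun_prop) measurable_const
    _ = ENNReal.ofReal q * (2 * ∫⁻ x, ENNReal.ofReal (2 ^ (q-1) / (q-1)) * φ x ^ q ∂μ) := by
        congr 3; funext x
        have hq1 : 0 < q - 1 := by linarith
        have := layer (q-1) hq1 (2 * φ x)
        have h2 : ∀ I : ℝ≥0∞, ENNReal.ofReal (q-1) * I = (2 * φ x)^(q-1) → I = ENNReal.ofReal (2 ^ (q-1) / (q-1)) * φ x ^ (q-1) := by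
          intro I hI
          rw [ENNReal.mul_rpow_of_nonneg _ _ hq1.le] at hI
          have h3 : (2:ℝ≥0∞)^(q-1) = ENNReal.ofReal (2 ^ (q-1)) := by
            rw [← ENNReal.ofReal_rpow_of_pos (by norm_num)]; simp
          rw [h3] at hI
          rw [ENNReal.ofReal_div_of_pos hq1, div_eq_mul_inv, mul_right_comm, ← hI, mul_comm, ← mul_assoc,
            ENNReal.inv_mul_cancel (by simpa using hq1) ENNReal.ofReal_ne_top, one_mul]
        rw [h2 _ this, mul_left_comm]
        congr 1
        rw [mul_comm]
        nth_rewrite 2 [← ENNReal.rpow_one (φ x)]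
        rw [← ENNReal.rpow_add_of_nonneg _ _ hq1.le zero_le_one]; ring_nf
    _ = _ := by
        rw [lintegral_const_mul' _ _ ENNReal.ofReal_ne_top, ← mul_assoc, ← mul_assoc]
        congr 1
        have : (2:ℝ≥0∞) = ENNReal.ofReal 2 := by simp
        rw [this, ← ENNReal.ofReal_mul hq0.le, ← ENNReal.ofReal_mul (by positivity)]
        congr 1
        have h4 : (2:ℝ)^q = 2 ^ (q-1) * 2 := by rw [← Real.rpow_add_one (by norm_num)]; ring_nf
        rw [h4]; ring

end

noncomputable section

lemma rising_sun (f : ℝ → ℝ≥0∞) (hf : Measurable f) (x l : ℝ) (hl : 0 ≤ l)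
    (h : ENNReal.ofReal l < Mx volume f x) :
    ∃ b, x < b ∧ ∀ y, x ≤ y → y ≤ b → ENNReal.ofReal (l * (b - y)) ≤ ∫⁻ t in Ioo y b, f t := by
  obtain ⟨c, hc⟩ := lt_iSup_iff.1 h
  obtain ⟨hxc, hc⟩ := lt_iSup_iff.1 hc
  rw [Real.volume_Ioo, ENNReal.lt_div_iff_mul_lt (by simp [hxc]) (by simp),
    ← ENNReal.ofReal_mul hl] at hc
  have hsup : ∫⁻ t in Ioo x c, f t = ⨆ N : ℕ, ∫⁻ t in Ioo x c, min (f t) N := by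
    rw [← lintegral_iSup]
    · congr 1; funext t
      rw [← inf_iSup_eq, ENNReal.iSup_natCast, inf_top_eq]
    · intro N; fun_prop
    · intro a b hab t
      show min _ _ ≤ min _ _
      gcongr
  rw [hsup] at hc
  obtain ⟨N, hN⟩ := lt_iSup_iff.1 hc
  set F : ℝ → ℝ := fun t => (min (f t) N).toReal with hF
  have hFm : Measurable F := by fun_prop
  have hF0 : ∀ t, 0 ≤ F t := fun t => ENNReal.toReal_nonneg
  have hFN : ∀ t, F t ≤ N := by
    intro t
    have := ENNReal.toReal_mono (ENNReal.natCast_ne_top N) (min_le_right (f t) N)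
    simpa using this
  have hne : ∀ t, min (f t) N ≠ ∞ := fun t => ne_top_of_le_ne_top (ENNReal.natCast_ne_top N) (min_le_right _ _)
  have hint : ∀ a b, IntervalIntegrable F volume a b := by
    intro a b
    refine (intervalIntegrable_const (c := (N:ℝ))).mono_fun hFm.aestronglyMeasurable ?_
    filter_upwards with t
    rw [Real.norm_of_nonneg (hF0 t), Real.norm_of_nonneg (by positivity)]
    exact hFN t
  have hconv : ∀ a b, a ≤ b → ∫⁻ t in Ioo a b, min (f t) N = ENNReal.ofReal (∫ t in a..b, F t) := by
    intro a b hab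
    rw [intervalIntegral.integral_of_le hab, integral_Ioc_eq_integral_Ioo,
      ofReal_integral_eq_lintegral_ofReal]
    · congr 1; funext t; rw [hF]; exact (ENNReal.ofReal_toReal (hne t)).symm
    · exact (((intervalIntegrable_iff_integrableOn_Ioo_of_le hab).1 (hint a b)))
    · filter_upwards with t; exact hF0 t
  set G : ℝ → ℝ := fun y => (∫ t in x..y, F t) - l * (y - x) with hG
  have hGc : Continuous G := by
    have := intervalIntegral.continuous_primitive hint x
    fun_prop
  obtain ⟨b, hb, hmax⟩ := isCompact_Icc.exists_isMaxOn (nonempty_Icc.2 hxc.le) hGc.continuousOn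
  have hGc0 : 0 < G c := by
    rw [hconv x c hxc.le, ENNReal.ofReal_lt_ofReal_iff_of_nonneg (by nlinarith)] at hN
    simp only [hG]; linarith
  have hGx : G x = 0 := by simp [hG]
  have hGb : G c ≤ G b := hmax (right_mem_Icc.2 hxc.le)
  refine ⟨b, ?_, ?_⟩
  · rcases hb.1.lt_or_eq with h | h
    · exact h
    · rw [← h, hGx] at hGb; linarith
  · intro y hxy hyb
    have h1 : G y ≤ G b := hmax ⟨hxy, hyb.trans hb.2⟩
    calc ENNReal.ofReal (l * (b - y)) ≤ ENNReal.ofReal (∫ t in y..b, F t) := by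
          apply ENNReal.ofReal_le_ofReal
          have := intervalIntegral.integral_add_adjacent_intervals (hint x y) (hint y b)
          simp only [hG] at h1
          linarith
      _ = ∫⁻ t in Ioo y b, min (f t) N := (hconv y b hyb).symm
      _ ≤ _ := lintegral_mono fun t => min_le_left _ _

/-- Hypotheses on a one-dimensional weight. -/
structure Wt (p : ℝ) (w : ℝ → ℝ≥0∞) (K : ℝ≥0∞) : Prop where
  hp : 1 < p
  hK : K ≠ ∞
  meas : Measurable w
  pos : ∀ t, 0 < w t
  fin : ∀ t, w t < ∞
  ap : ∀ x h : ℝ, 0 < h → (∫⁻ t in Ioo (x-h) x, w t) *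
    (∫⁻ t in Ioo x (x+h), (w t) ^ (-(1/(p-1)))) ^ (p-1) ≤ K * ENNReal.ofReal h ^ p

namespace Wt
variable {p : ℝ} {w : ℝ → ℝ≥0∞} {K : ℝ≥0∞}

def sg (p : ℝ) (w : ℝ → ℝ≥0∞) : ℝ → ℝ≥0∞ := fun t => (w t) ^ (-(1/(p-1)))

lemma sg_meas (H : Wt p w K) : Measurable (sg p w) := H.meas.pow_const _

lemma sg_pos (H : Wt p w K) (t : ℝ) : 0 < sg p w t :=
  ENNReal.rpow_pos (H.pos t) (H.fin t).ne
lemma sg_fin (H : Wt p w K) (t : ℝ) : sg p w t < ∞ :=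
  lt_top_iff_ne_top.2 (ENNReal.rpow_ne_top_of_ne_zero (H.pos t).ne' (H.fin t).ne)

lemma pos_int {g : ℝ → ℝ≥0∞} (hg : Measurable g) (h0 : ∀ t, 0 < g t) {a b : ℝ} (hab : a < b) :
    0 < ∫⁻ t in Ioo a b, g t := by
  rw [setLIntegral_pos_iff hg]
  have : Function.support g = univ := by
    ext t; simp [(h0 t).ne']
  simp [this, hab]

lemma fin_w (H : Wt p w K) (a b : ℝ) : ∫⁻ t in Ioo a b, w t < ∞ := by
  rcases le_or_gt b a with h | h
  · simp [Ioo_eq_empty (not_lt.2 h)]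
  have h1 := H.ap b (b-a) (by linarith)
  rw [sub_sub_cancel] at h1
  have h2 := pos_int H.sg_meas H.sg_pos (show b < b + (b-a) by linarith)
  have hp := H.hp
  by_contra hcon
  rw [not_lt, top_le_iff] at hcon
  rw [hcon, ENNReal.top_mul] at h1
  · rw [top_le_iff] at h1
    exact ENNReal.mul_ne_top H.hK (ENNReal.rpow_ne_top_of_nonneg (by linarith) ENNReal.ofReal_ne_top) h1
  · intro h3
    rw [ENNReal.rpow_eq_zero_iff_of_pos (by linarith)] at h3
    exact h2.ne' h3

lemma fin_s (H : Wt p w K) (a b : ℝ) : ∫⁻ t in Ioo a b, sg p w t < ∞ := by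
  rcases le_or_gt b a with h | h
  · simp [Ioo_eq_empty (not_lt.2 h)]
  have h1 := H.ap a (b-a) (by linarith)
  rw [add_sub_cancel] at h1
  have h2 := pos_int H.meas H.pos (show a - (b-a) < a by linarith)
  have hp := H.hp
  by_contra hcon
  rw [not_lt, top_le_iff] at hcon
  unfold sg at hcon
  rw [hcon, ENNReal.top_rpow_of_pos (by linarith), ENNReal.mul_top h2.ne'] at h1
  rw [top_le_iff] at h1
  exact ENNReal.mul_ne_top H.hK (ENNReal.rpow_ne_top_of_nonneg (by linarith) ENNReal.ofReal_ne_top) h1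

lemma holder (H : Wt p w K) (a b : ℝ) : ENNReal.ofReal (b - a) ^ p ≤
    (∫⁻ t in Ioo a b, w t) * (∫⁻ t in Ioo a b, sg p w t) ^ (p-1) := by
  have hp := H.hp
  have hpq : p.HolderConjugate (p / (p-1)) := Real.HolderConjugate.conjExponent hp
  have := ENNReal.lintegral_mul_le_Lp_mul_Lq (volume.restrict (Ioo a b)) hpq
    (f := fun t => (w t)^(1/p)) (g := fun t => (w t) ^(-(1/p)))
    (H.meas.pow_const _).aemeasurable (H.meas.pow_const _).aemeasurable
  have e1 : ∀ t, ((fun t => (w t)^(1/p)) * (fun t => (w t) ^(-(1/p)))) t = 1 := by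
    intro t
    simp only [Pi.mul_apply]
    rw [← ENNReal.rpow_add _ _ (H.pos t).ne' (H.fin t).ne]; simp
  have e2 : ∀ t, ((w t)^(1/p))^p = w t := by
    intro t; rw [← ENNReal.rpow_mul, one_div_mul_cancel (by linarith), ENNReal.rpow_one]
  have e3 : ∀ t, ((w t)^(-(1/p)))^(p/(p-1)) = sg p w t := by
    intro t; rw [← ENNReal.rpow_mul]; unfold sg; congr 1
    have : p - 1 ≠ 0 := by linarith
    field_simp
  simp only [e1, e2, e3] at this
  simp only [lintegral_const, Measure.restrict_apply_univ, Real.volume_Ioo, one_mul] at this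
  calc _ ≤ _ := ENNReal.rpow_le_rpow this (by linarith)
    _ = _ := by
      rw [ENNReal.mul_rpow_of_nonneg _ _ (by linarith), ← ENNReal.rpow_mul, ← ENNReal.rpow_mul,
        one_div_mul_cancel (by linarith), ENNReal.rpow_one]
      congr 2
      have : p - 1 ≠ 0 := by linarith
      field_simp

/-- stopping -/
lemma cutoff (H : Wt p w K) (x b : ℝ) (hxb : x < b) : ∃ r, 0 < r ∧ x ≤ b - 2 * r ∧
    (∫⁻ t in Ioo x (b-r), w t) * (∫⁻ t in Ioo (b - 2*r) b, sg p w t) ^ (p-1) ≤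
      4 * K * ENNReal.ofReal (2 * r) ^ p := by
  have hp := H.hp
  have hp1 : 0 < p - 1 := by linarith
  set r : ℕ → ℝ := fun j => (b - x) * (1/2)^j with hr
  have hrpos : ∀ j, 0 < r j := fun j => by have : 0 < b - x := by linarith
                                           simp only [hr]; positivity
  have hrs : ∀ j, r j = 2 * r (j+1) := fun j => by simp only [hr, pow_succ]; ring
  have hr0 : r 0 = b - x := by simp [hr]
  have hrle : ∀ j, r j ≤ b - x := by
    intro j
    induction j with
    | zero => rw [hr0]
    | succ j ih => have := hrs j; have := hrpos j; linarith
  set s : ℕ → ℝ≥0∞ := fun j => ∫⁻ t in Ioo (b - r j) b, sg p w t with hs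
  set om : ℕ → ℝ≥0∞ := fun j => ∫⁻ t in Ioo x (b - r j), w t with hom
  set L : ℕ → ℝ≥0∞ := fun j => ∫⁻ t in Ioo (b - r j) (b - r (j+1)), w t with hL
  set R : ℕ → ℝ≥0∞ := fun j => ENNReal.ofReal (r j) ^ p with hR
  have hRs : ∀ j, R j = 2 ^ p * R (j+1) := by
    intro j
    simp only [hR]
    rw [hrs j, ENNReal.ofReal_mul (by norm_num), ENNReal.mul_rpow_of_nonneg _ _ (by linarith)]
    simp
  have homs : ∀ j, om (j+1) = om j + L j := by
    intro j
    simp only [hom, hL]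
    rw [setLIntegral_congr (Ioo_ae_eq_Ioc (a := x) (b := b - r j)), ← lintegral_union measurableSet_Ioo]
    · congr 2
      exact (Ioc_union_Ioo_eq_Ioo (by linarith [hrle j]) (by linarith [hrs j, hrpos (j+1)])).symm
    · exact disjoint_left.2 fun t h1 h2 => (h1.2.trans_lt h2.1).false
  have hap : ∀ j, L j * s (j+1) ^ (p-1) ≤ K * R (j+1) := by
    intro j
    have := H.ap (b - r (j+1)) (r (j+1)) (hrpos _)
    have e : b - r (j+1) - r (j+1) = b - r j := by linarith [hrs j]
    rw [e, sub_add_cancel] at this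
    exact this
  -- rho^(p-1) = 2^(-(p+1))
  set D : ℝ≥0∞ := 2 ^ (p+1) with hD
  have hD0 : D ≠ 0 := by simp [hD]
  have hDt : D ≠ ∞ := by simp [hD]
  have hDp : D = 2 * 2 ^ p := by
    rw [hD, ENNReal.rpow_add _ _ (by simp) (by simp), ENNReal.rpow_one, mul_comm]
  -- good index
  have hex : ∃ m, s m ^ (p-1) ≤ D * s (m+1) ^ (p-1) := by
    by_contra hcon
    push Not at hcon
    have h1 : ∀ j, D ^ j * s j ^ (p-1) ≤ s 0 ^ (p-1) := by
      intro j
      induction j with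
      | zero => simp
      | succ j ih => 
        calc D ^ (j+1) * s (j+1) ^ (p-1) = D ^ j * (D * s (j+1) ^ (p-1)) := by rw [pow_succ]; ring
          _ ≤ D ^ j * s j ^ (p-1) := mul_le_mul_right (hcon j).le _
          _ ≤ _ := ih
    have h2 : ∀ j, R j ≤ (∫⁻ t in Ioo x b, w t) * s j ^ (p-1) := by
      intro j
      have := H.holder (b - r j) b
      rw [sub_sub_cancel] at this
      refine this.trans ?_
      gcongr
      linarith [hrle j]
    have h3 : ∀ j, (2^p)^j * R j = R 0 := by
      intro j
      induction j with
      | zero => simp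
      | succ j ih => rw [← ih, hRs j, pow_succ]; ring
    have h4 : ∀ j : ℕ, 2 ^ j * R 0 ≤ (∫⁻ t in Ioo x b, w t) * s 0 ^ (p-1) := by
      intro j
      calc 2 ^ j * R 0 = D ^ j * R j := by rw [← h3 j, hDp, mul_pow]; ring
        _ ≤ D ^ j * ((∫⁻ t in Ioo x b, w t) * s j ^ (p-1)) := mul_le_mul_right (h2 j) _
        _ = (∫⁻ t in Ioo x b, w t) * (D ^ j * s j ^ (p-1)) := by ring
        _ ≤ _ := mul_le_mul_right (h1 j) _
    have hfin : (∫⁻ t in Ioo x b, w t) * s 0 ^ (p-1) < ∞ :=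
      ENNReal.mul_lt_top (H.fin_w _ _) (ENNReal.rpow_lt_top_of_nonneg hp1.le (H.fin_s _ _).ne)
    have hR0 : R 0 ≠ 0 := by
      simp only [hR]
      exact (ENNReal.rpow_pos (by simpa using hrpos 0) ENNReal.ofReal_ne_top).ne'
    have hRt : R 0 ≠ ∞ := by
      simp only [hR]
      exact ENNReal.rpow_ne_top_of_nonneg (by linarith) ENNReal.ofReal_ne_top
    have h5 : ∀ j : ℕ, (2:ℝ≥0∞) ^ j ≤ ((∫⁻ t in Ioo x b, w t) * s 0 ^ (p-1)) / R 0 := by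
      intro j
      rw [ENNReal.le_div_iff_mul_le (Or.inl hR0) (Or.inl hRt)]
      exact h4 j
    have h6 : ((∫⁻ t in Ioo x b, w t) * s 0 ^ (p-1)) / R 0 < ∞ := ENNReal.div_lt_top hfin.ne hR0
    obtain ⟨n, hn⟩ := ENNReal.exists_nat_gt h6.ne
    have h7 : ((n:ℕ):ℝ≥0∞) ≤ 2 ^ n := by exact_mod_cast Nat.lt_two_pow_self.le
    exact (hn.trans_le h7).not_ge (h5 n)
  classical
  set m := Nat.find hex with hm
  have hmm : s m ^ (p-1) ≤ D * s (m+1) ^ (p-1) := Nat.find_spec hex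
  have hmin : ∀ j < m, D * s (j+1) ^ (p-1) ≤ s j ^ (p-1) := by
    intro j hj
    exact (not_le.1 (Nat.find_min hex hj)).le
  have claim : ∀ j ≤ m, om j * s j ^ (p-1) ≤ 2 * K * R j := by
    intro j
    induction j with
    | zero => intro _; simp [hom, hr0]
    | succ j ih =>
      intro hj
      have h1 := ih (by omega)
      have h2 := hmin j (by omega)
      have h3 : D * (om j * s (j+1)^(p-1)) ≤ D * (K * R (j+1)) := by
        calc D * (om j * s (j+1)^(p-1)) = om j * (D * s (j+1)^(p-1)) := by ring
          _ ≤ om j * s j ^ (p-1) := mul_le_mul_right h2 _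
          _ ≤ 2 * K * R j := h1
          _ = D * (K * R (j+1)) := by rw [hRs j, hDp]; ring
      have h4 := (ENNReal.mul_le_mul_iff_right hD0 hDt).1 h3
      rw [homs, add_mul]
      calc _ ≤ K * R (j+1) + K * R (j+1) := add_le_add h4 (hap j)
        _ = _ := by ring
  refine ⟨r (m+1), hrpos _, ?_, ?_⟩
  · have := hrs m; have := hrle m; linarith
  · rw [← hrs m]
    show om (m+1) * s m ^ (p-1) ≤ 4 * K * R m
    rw [homs, add_mul]
    have h1 : L m * s m ^ (p-1) ≤ 2 * K * R m := by
      calc L m * s m ^ (p-1) ≤ L m * (D * s (m+1)^(p-1)) := mul_le_mul_right hmm _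
        _ = D * (L m * s (m+1)^(p-1)) := by ring
        _ ≤ D * (K * R (m+1)) := mul_le_mul_right (hap m) _
        _ = 2 * K * R m := by rw [hRs m, hDp]; ring
    calc _ ≤ 2 * K * R m + 2 * K * R m := add_le_add (claim m le_rfl) h1
      _ = _ := by ring

end Wt
end

noncomputable section
namespace Wt
variable {p : ℝ} {w : ℝ → ℝ≥0∞} {K : ℝ≥0∞}

lemma lf {g : ℝ → ℝ≥0∞} (h : ∀ a b : ℝ, ∫⁻ t in Ioo a b, g t < ∞) :
    IsLocallyFiniteMeasure (volume.withDensity g) := by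
  refine ⟨fun x => ⟨Ioo (x-1) (x+1), Ioo_mem_nhds (by linarith) (by linarith), ?_⟩⟩
  rw [withDensity_apply _ measurableSet_Ioo]; exact h _ _

lemma na {g : ℝ → ℝ≥0∞} : NullSingletonClass (volume.withDensity g : Measure ℝ) := by
  refine ⟨fun x => withDensity_absolutelyContinuous _ _ (by simp)⟩

lemma pointwise (H : Wt p w K) (f : ℝ → ℝ≥0∞) (hf : Measurable f) (x : ℝ) :
    (Mx volume f x) ^ (p-1) ≤ ENNReal.ofReal (2 ^ p * 4 * 2 ^ p) * K * Mx (volume.withDensity w)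
      (fun t => (Mx (volume.withDensity (sg p w)) (fun t => f t / sg p w t) t) ^ (p-1) / w t) x := by
  have hp := H.hp
  have hp1 : 0 < p - 1 := by linarith
  have := lf H.fin_w
  have := lf H.fin_s
  set S := volume.withDensity (sg p w) with hS
  set W := volume.withDensity w with hW
  set gg := Mx S (fun t => f t / sg p w t) with hgg
  have hggm : Measurable gg := measurable_Mx _ _
  set ψ := (fun t => gg t ^ (p-1) / w t) with hψ
  have key : ∀ l : ℝ, 0 < l → ENNReal.ofReal l < Mx volume f x →
      ENNReal.ofReal l ^ (p-1) ≤ ENNReal.ofReal (2 ^ p * 4 * 2 ^ p) * K * Mx W ψ x := by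
    intro l hl hlx
    obtain ⟨b, hxb, hb⟩ := rising_sun f hf x l hl.le hlx
    obtain ⟨r, hr, hxr, hst⟩ := H.cutoff x b hxb
    set s := ∫⁻ t in Ioo (b - 2*r) b, sg p w t with hs
    set om := ∫⁻ t in Ioo x (b-r), w t with hom
    set ρ := ENNReal.ofReal r with hρ
    have hρ0 : ρ ≠ 0 := by simpa [hρ] using hr
    have hρt : ρ ≠ ∞ := ENNReal.ofReal_ne_top
    have h1 : ∀ y ∈ Ioo (b - 2*r) (b-r), ENNReal.ofReal l * ρ ≤ gg y * s := by
      intro y hy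
      have hyb : y < b := by linarith [hy.2]
      have e1 := lint_le_Mx S (fun t => f t / sg p w t) hyb
      rw [hS, setLIntegral_withDensity_eq_setLIntegral_mul _ H.sg_meas (show Measurable (fun t => f t / sg p w t) from hf.div H.sg_meas) measurableSet_Ioo,
        withDensity_apply _ measurableSet_Ioo, ← hS] at e1
      have e2 : ∀ t, (sg p w * fun t => f t / sg p w t) t = f t := by
        intro t
        simp only [Pi.mul_apply]
        exact ENNReal.mul_div_cancel (H.sg_pos t).ne' (H.sg_fin t).ne
      simp only [e2] at e1
      calc ENNReal.ofReal l * ρ ≤ ENNReal.ofReal (l * (b - y)) := by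
            rw [hρ, ← ENNReal.ofReal_mul hl.le]
            apply ENNReal.ofReal_le_ofReal
            have := hy.2; gcongr; linarith
        _ ≤ ∫⁻ t in Ioo y b, f t := hb y (by linarith [hy.1]) hyb.le
        _ ≤ _ := e1
        _ ≤ gg y * s := by
            apply mul_le_mul_right
            exact lintegral_mono_set (Ioo_subset_Ioo_left hy.1.le)
    have hst0 : s ≠ ∞ := (H.fin_s _ _).ne
    have hsp : s ^ (p-1) ≠ ∞ := ENNReal.rpow_ne_top_of_nonneg hp1.le hst0
    have h2 : (ENNReal.ofReal l * ρ) ^ (p-1) * ρ ≤ s ^ (p-1) * ∫⁻ t in Ioo (b - 2*r) (b-r), gg t ^ (p-1) := by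
      calc (ENNReal.ofReal l * ρ) ^ (p-1) * ρ = ∫⁻ t in Ioo (b - 2*r) (b-r), (ENNReal.ofReal l * ρ) ^ (p-1) := by
            simp [hρ]; congr 2; ring
        _ ≤ ∫⁻ t in Ioo (b - 2*r) (b-r), s ^ (p-1) * gg t ^ (p-1) := by
            refine setLIntegral_mono' measurableSet_Ioo fun y hy => ?_
            rw [← ENNReal.mul_rpow_of_nonneg _ _ hp1.le, mul_comm s]
            exact ENNReal.rpow_le_rpow (h1 y hy) hp1.le
        _ = _ := by rw [lintegral_const_mul' _ _ hsp]
    have h3 : ∫⁻ t in Ioo (b - 2*r) (b-r), gg t ^ (p-1) ≤ Mx W ψ x * om := by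
      have e1 := lint_le_Mx W ψ (show x < b - r by linarith)
      rw [hW, setLIntegral_withDensity_eq_setLIntegral_mul _ H.meas (show Measurable ψ from (hggm.pow_const _).div H.meas) measurableSet_Ioo,
        withDensity_apply _ measurableSet_Ioo, ← hW] at e1
      have e2 : ∀ t, (w * ψ) t = gg t ^ (p-1) := by
        intro t
        simp only [Pi.mul_apply, hψ]
        exact ENNReal.mul_div_cancel (H.pos t).ne' (H.fin t).ne
      simp only [e2] at e1
      exact (lintegral_mono_set (Ioo_subset_Ioo_left hxr)).trans e1
    have hpp : ∀ a : ℝ≥0∞, a ≠ 0 → a ≠ ∞ → a ^ (p-1) * a = a ^ p := by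
      intro a h0 ht
      nth_rewrite 2 [← ENNReal.rpow_one a]
      rw [← ENNReal.rpow_add _ _ h0 ht, sub_add_cancel]
    have hρp0 : ρ ^ p ≠ 0 := (ENNReal.rpow_pos (pos_iff_ne_zero.2 hρ0) hρt).ne'
    have hρpt : ρ ^ p ≠ ∞ := ENNReal.rpow_ne_top_of_nonneg (by linarith) hρt
    have h4 : ENNReal.ofReal l ^ (p-1) * ρ ^ p ≤ (ENNReal.ofReal (2 ^ p * 4 * 2 ^ p) * K * Mx W ψ x) * ρ ^ p := by
      calc ENNReal.ofReal l ^ (p-1) * ρ ^ p = (ENNReal.ofReal l * ρ) ^ (p-1) * ρ := by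
            rw [ENNReal.mul_rpow_of_nonneg _ _ hp1.le, mul_assoc, hpp ρ hρ0 hρt]
        _ ≤ _ := h2
        _ ≤ s ^ (p-1) * (Mx W ψ x * om) := mul_le_mul_right h3 _
        _ = (om * s ^ (p-1)) * Mx W ψ x := by ring
        _ ≤ (4 * K * ENNReal.ofReal (2 * r) ^ p) * Mx W ψ x := mul_le_mul_left hst _
        _ = (ENNReal.ofReal (4 * 2 ^ p) * K * Mx W ψ x) * ρ ^ p := by
            rw [ENNReal.ofReal_mul (by norm_num), ENNReal.mul_rpow_of_nonneg _ _ (by linarith),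
              ENNReal.ofReal_mul (by norm_num), ← ENNReal.ofReal_rpow_of_pos (by norm_num)]
            simp only [ENNReal.ofReal_ofNat, hρ]; ring
        _ ≤ _ := by
            gcongr
            have : (1:ℝ) ≤ 2 ^ p := Real.one_le_rpow (by norm_num) (by linarith)
            nlinarith
    exact (ENNReal.mul_le_mul_iff_left hρp0 hρpt).1 h4
  rw [← ENNReal.le_rpow_inv_iff hp1]
  refine le_of_forall_lt fun c hc => ?_
  obtain ⟨d, hcd, hd⟩ := exists_between hc
  have hdt : d ≠ ∞ := hd.ne_top
  have hd0 : d ≠ 0 := (bot_lt_iff_ne_bot.1 (lt_of_le_of_lt bot_le hcd))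
  refine hcd.trans_le ?_
  rw [ENNReal.le_rpow_inv_iff hp1]
  have := key d.toReal (ENNReal.toReal_pos hd0 hdt) (by rwa [ENNReal.ofReal_toReal hdt])
  rwa [ENNReal.ofReal_toReal hdt] at this

def Cp (p : ℝ) : ℝ≥0∞ := (ENNReal.ofReal (2 ^ p * 4 * 2 ^ p)) ^ (p/(p-1)) *
  (ENNReal.ofReal (2^(p/(p-1))*((p/(p-1))/((p/(p-1))-1))) * ENNReal.ofReal (2^p*(p/(p-1))))

lemma Cp_ne_top (hp : 1 < p) : Cp p ≠ ∞ := by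
  unfold Cp
  have : 0 ≤ p / (p-1) := div_nonneg (by linarith) (by linarith)
  exact ENNReal.mul_ne_top (ENNReal.rpow_ne_top_of_nonneg this ENNReal.ofReal_ne_top)
    (ENNReal.mul_ne_top ENNReal.ofReal_ne_top ENNReal.ofReal_ne_top)

lemma oneD (H : Wt p w K) (f : ℝ → ℝ≥0∞) (hf : Measurable f) :
    ∫⁻ x, (Mx volume f x) ^ p * w x ≤ Cp p * K ^ (p/(p-1)) * ∫⁻ x, f x ^ p * w x := by
  have hp := H.hp
  have hp1 : 0 < p - 1 := by linarith
  have hp0 : 0 < p := by linarith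
  set q := p / (p-1) with hq
  have hq1 : 1 < q := by rw [hq, lt_div_iff₀ hp1]; linarith
  have hq0 : 0 < q := by linarith
  have hpq : (p-1) * q = p := by rw [hq]; field_simp
  have := lf H.fin_w
  have := lf H.fin_s
  have := na (g := w)
  have := na (g := sg p w)
  have hpt := H.pointwise f hf
  set S := volume.withDensity (sg p w) with hS
  set W := volume.withDensity w with hW
  set gg := Mx S (fun t => f t / sg p w t) with hgg
  have hggm : Measurable gg := measurable_Mx _ _
  set ψ := (fun t => gg t ^ (p-1) / w t) with hψ
  have hψm : Measurable ψ := (hggm.pow_const _).div H.meas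
  have hfm : Measurable (fun t => f t / sg p w t) := hf.div H.sg_meas
  have s1 := strong_type q hq1 W ψ hψm
  have s2 := strong_type p hp S _ hfm
  have i1 : ∫⁻ x, (Mx W ψ x) ^ q ∂W = ∫⁻ x, (Mx W ψ x) ^ q * w x := by
    rw [hW, lintegral_withDensity_eq_lintegral_mul _ H.meas
      (show Measurable (fun x => (Mx (volume.withDensity w) ψ x) ^ q) from (measurable_Mx _ _).pow_const _)]
    simp [mul_comm]
  have i2 : ∫⁻ x, (ψ x) ^ q ∂W = ∫⁻ x, gg x ^ p ∂S := by
    rw [hW, hS, lintegral_withDensity_eq_lintegral_mul _ H.meas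
      (show Measurable (fun x => (ψ x) ^ q) from hψm.pow_const _),
      lintegral_withDensity_eq_lintegral_mul _ H.sg_meas
      (show Measurable (fun x => (gg x) ^ p) from hggm.pow_const _)]
    congr 1; ext x
    simp only [Pi.mul_apply, hψ]
    have h0 := (H.pos x).ne'
    have ht := (H.fin x).ne
    rw [div_eq_mul_inv, ENNReal.mul_rpow_of_nonneg _ _ hq0.le, ← ENNReal.rpow_mul, hpq,
      ← ENNReal.rpow_neg_one, ← ENNReal.rpow_mul, mul_left_comm]
    nth_rewrite 1 [← ENNReal.rpow_one (w x)]
    rw [← ENNReal.rpow_add _ _ h0 ht, mul_comm]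
    congr 2
    rw [hq]; field_simp; ring
  have i3 : ∫⁻ x, (f x / sg p w x) ^ p ∂S = ∫⁻ x, f x ^ p * w x := by
    rw [hS, lintegral_withDensity_eq_lintegral_mul _ H.sg_meas
      (show Measurable (fun x => (f x / sg p w x) ^ p) from hfm.pow_const _)]
    congr 1; ext x
    simp only [Pi.mul_apply]
    have h0 := (H.sg_pos x).ne'
    have ht := (H.sg_fin x).ne
    rw [div_eq_mul_inv, ENNReal.mul_rpow_of_nonneg _ _ hp0.le,
      ← ENNReal.rpow_neg_one, ← ENNReal.rpow_mul, mul_left_comm]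
    nth_rewrite 1 [← ENNReal.rpow_one (sg p w x)]
    rw [← ENNReal.rpow_add _ _ h0 ht]
    congr 1
    unfold sg
    rw [← ENNReal.rpow_mul]
    nth_rewrite 2 [← ENNReal.rpow_one (w x)]
    congr 1; field_simp; ring
  have hKt : (ENNReal.ofReal (2 ^ p * 4 * 2 ^ p) * K) ^ q ≠ ∞ :=
    ENNReal.rpow_ne_top_of_nonneg hq0.le (ENNReal.mul_ne_top ENNReal.ofReal_ne_top H.hK)
  calc ∫⁻ x, (Mx volume f x) ^ p * w x
      ≤ ∫⁻ x, (ENNReal.ofReal (2 ^ p * 4 * 2 ^ p) * K) ^ q * ((Mx W ψ x) ^ q * w x) := by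
        refine lintegral_mono fun x => ?_
        rw [← mul_assoc, ← ENNReal.mul_rpow_of_nonneg _ _ hq0.le]
        refine mul_le_mul_left ?_ _
        rw [← hpq, ENNReal.rpow_mul]
        exact ENNReal.rpow_le_rpow (by simpa [hpq] using hpt x) hq0.le
    _ = (ENNReal.ofReal (2 ^ p * 4 * 2 ^ p) * K) ^ q * ∫⁻ x, (Mx W ψ x) ^ q ∂W := by
        rw [lintegral_const_mul' _ _ hKt, i1]
    _ ≤ (ENNReal.ofReal (2 ^ p * 4 * 2 ^ p) * K) ^ q * (ENNReal.ofReal (2^q*(q/(q-1))) *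
          (ENNReal.ofReal (2^p*(p/(p-1))) * ∫⁻ x, f x ^ p * w x)) := by
        refine mul_le_mul_right (s1.trans (mul_le_mul_right ?_ _)) _
        rw [i2, ← i3]; exact s2
    _ = _ := by
        rw [ENNReal.mul_rpow_of_nonneg _ _ hq0.le]; unfold Cp; rw [← hq]; ring

end Wt
end

noncomputable section
namespace ND

lemma lint_slice {m : ℕ} (i : Fin (m+1)) (F : (Fin (m+1) → ℝ) → ℝ≥0∞) (hF : Measurable F) :
    ∫⁻ x, F x = ∫⁻ y : Fin m → ℝ, ∫⁻ t : ℝ, F (i.insertNth t y) := by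
  have h := (volume_preserving_piFinSuccAbove (fun _ : Fin (m+1) => ℝ) i).symm
  have h2 := MeasurePreserving.lintegral_map_equiv F _ h
  rw [h2, Measure.volume_eq_prod, lintegral_prod_symm]
  · rfl
  · exact (hF.comp (MeasurableEquiv.measurable _)).aemeasurable

lemma ae_slice {m : ℕ} (i : Fin (m+1)) {P : (Fin (m+1) → ℝ) → Prop} (hP : ∀ᵐ x, P x) :
    ∀ᵐ y : Fin m → ℝ, ∀ᵐ t : ℝ, P (i.insertNth t y) := by
  have h := (volume_preserving_piFinSuccAbove (fun _ : Fin (m+1) => ℝ) i).symm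
  have h1 := h.quasiMeasurePreserving.ae hP
  rw [Measure.volume_eq_prod] at h1
  have h2 := (Measure.measurePreserving_swap (μ := (volume : Measure (Fin m → ℝ))) (ν := (volume : Measure ℝ))).quasiMeasurePreserving.ae h1
  exact Measure.ae_ae_of_ae_prod h2

def Mi {n : ℕ} (i : Fin n) (g : (Fin n → ℝ) → ℝ≥0∞) (x : Fin n → ℝ) : ℝ≥0∞ :=
  Mx volume (fun t => g (Function.update x i t)) (x i)

lemma measurable_Mi {n : ℕ} (i : Fin n) (g : (Fin n → ℝ) → ℝ≥0∞) (hg : Measurable g) :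
    Measurable (Mi i g) := by
  unfold Mi
  simp only [Mx_rat]
  refine Measurable.iSup fun q => ?_
  refine Measurable.div ?_ ?_
  · have e : ∀ x : Fin n → ℝ, ∫⁻ t in Ioo (x i) (q:ℝ), g (Function.update x i t) =
        ∫⁻ t, ({z : (Fin n → ℝ) × ℝ | z.1 i < z.2 ∧ z.2 < q}.indicator
          (fun z => g (Function.update z.1 i z.2))) (x, t) := by
      intro x
      rw [← lintegral_indicator measurableSet_Ioo]
      congr 1
    simp only [e]
    apply Measurable.lintegral_prod_right'
    refine (hg.comp measurable_update').indicator ?_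
    exact (measurableSet_lt ((measurable_pi_apply i).comp measurable_fst) measurable_snd).inter
      (measurableSet_lt measurable_snd measurable_const)
  · simp only [Real.volume_Ioo]
    fun_prop

lemma slice_wt {p : ℝ} (hp : 1 < p) {u : ℝ → ℝ} {W : ℝ → ℝ≥0∞} (hW : Measurable W)
    (hpos : ∀ t, 0 < W t) (hfin : ∀ t, W t < ∞) (hu : ∀ᵐ t, ENNReal.ofReal (u t) = W t)
    {A : ℝ≥0∞} (hA : A ≠ ∞) (hc : apPlusChar p u ≤ A) : Wt p W A := by
  refine ⟨hp, hA, hW, hpos, hfin, fun x h hh => ?_⟩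
  have hp1 : 0 < p - 1 := by linarith
  have h1 : avgIoc u (x - h) x *
      avgIoc (fun t => u t ^ (-(1 / (p - 1)))) x (x + h) ^ (p - 1) ≤ A := by
    refine le_trans ?_ hc
    unfold apPlusChar
    exact le_iSup_of_le x (le_iSup_of_le h (le_iSup_of_le hh le_rfl))
  have e1 : lintIoc u (x - h) x = ∫⁻ t in Ioo (x-h) x, W t := by
    unfold lintIoc
    rw [setLIntegral_congr Ioo_ae_eq_Ioc]
    exact lintegral_congr_ae (ae_restrict_of_ae hu)
  have e2 : lintIoc (fun t => u t ^ (-(1 / (p - 1)))) x (x + h) =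
      ∫⁻ t in Ioo x (x+h), W t ^ (-(1 / (p - 1))) := by
    unfold lintIoc
    rw [setLIntegral_congr Ioo_ae_eq_Ioc]
    refine lintegral_congr_ae (ae_restrict_of_ae ?_)
    filter_upwards [hu] with t ht
    have : 0 < u t := by rw [← ENNReal.ofReal_pos, ht]; exact hpos t
    rw [← ht, ENNReal.ofReal_rpow_of_pos this]
  unfold avgIoc at h1
  rw [e1, e2, sub_sub_cancel, add_sub_cancel_left] at h1
  set a := ∫⁻ t in Ioo (x-h) x, W t
  set b := ∫⁻ t in Ioo x (x+h), W t ^ (-(1 / (p - 1)))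
  have h0 : ENNReal.ofReal h ≠ 0 := by simpa using hh
  have ht : ENNReal.ofReal h ≠ ∞ := ENNReal.ofReal_ne_top
  have e3 : ENNReal.ofReal h ^ p * ((ENNReal.ofReal h)⁻¹ * ((ENNReal.ofReal h)⁻¹) ^ (p-1)) = 1 := by
    rw [ENNReal.inv_rpow, ← ENNReal.rpow_neg_one, ← ENNReal.rpow_neg, ← ENNReal.rpow_add _ _ h0 ht,
      ← ENNReal.rpow_add _ _ h0 ht]
    ring_nf; simp
  calc a * b ^ (p-1) = (ENNReal.ofReal h ^ p * ((ENNReal.ofReal h)⁻¹ * ((ENNReal.ofReal h)⁻¹) ^ (p-1))) * (a * b ^ (p-1)) := by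
        rw [e3, one_mul]
    _ = ((ENNReal.ofReal h)⁻¹ * a * ((ENNReal.ofReal h)⁻¹ * b) ^ (p-1)) * ENNReal.ofReal h ^ p := by
        rw [ENNReal.mul_rpow_of_nonneg _ _ hp1.le]; ring
    _ ≤ _ := mul_le_mul_left h1 _

lemma step {n : ℕ} {p : ℝ} (hp : 1 < p) {w : (Fin n → ℝ) → ℝ} {W : (Fin n → ℝ) → ℝ≥0∞}
    (hW : Measurable W) (hpos : ∀ t, 0 < W t) (hfin : ∀ t, W t < ∞)
    (hu : ∀ᵐ x, ENNReal.ofReal (w x) = W x) (i : Fin n) (hA : apPlusVar p w i ≠ ∞)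
    (g : (Fin n → ℝ) → ℝ≥0∞) (hg : Measurable g) :
    ∫⁻ x, (Mi i g x) ^ p * W x ≤
      Wt.Cp p * (apPlusVar p w i) ^ (p/(p-1)) * ∫⁻ x, g x ^ p * W x := by
  obtain ⟨m, rfl⟩ : ∃ m, n = m + 1 := ⟨n - 1, by have := i.pos; omega⟩
  rw [lint_slice i (fun x => Mi i g x ^ p * W x) (((measurable_Mi i g hg).pow_const _).mul hW),
    lint_slice i (fun x => g x ^ p * W x) ((hg.pow_const _).mul hW)]
  have hCt : Wt.Cp p * (apPlusVar p w i) ^ (p/(p-1)) ≠ ∞ :=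
    ENNReal.mul_ne_top (Wt.Cp_ne_top hp)
      (ENNReal.rpow_ne_top_of_nonneg (div_nonneg (by linarith) (by linarith)) hA)
  rw [← lintegral_const_mul' _ _ hCt]
  refine lintegral_mono_ae ?_
  have h1 := ae_slice i (ENNReal.ae_le_essSup
    (μ := volume) (fun x : Fin (m+1) → ℝ => apPlusChar p (fun t => w (Function.update x i t))))
  filter_upwards [h1, ae_slice i hu] with y hy1 hy2
  obtain ⟨t0, ht0⟩ := hy1.exists
  simp only [Fin.update_insertNth] at ht0
  have hins : Measurable (fun t : ℝ => (i.insertNth t y : Fin (m+1) → ℝ)) := by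
    have : Measurable (fun t : ℝ => ((MeasurableEquiv.piFinSuccAbove (fun _ : Fin (m+1) => ℝ) i).symm (t, y))) :=
      (MeasurableEquiv.measurable _).comp (measurable_id.prodMk measurable_const)
    exact this
  have H : Wt p (fun t => W (i.insertNth t y)) (apPlusVar p w i) :=
    slice_wt hp (hW.comp hins) (fun _ => hpos _) (fun _ => hfin _) hy2 hA ht0
  have := H.oneD (fun t => g (i.insertNth t y)) (hg.comp hins)
  simpa only [Mi, Fin.update_insertNth, Fin.insertNth_apply_same] using this

def MM {n : ℕ} (g : (Fin n → ℝ) → ℝ≥0∞) : List (Fin n) → (Fin n → ℝ) → ℝ≥0∞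
  | [] => g
  | (i :: l) => Mi i (MM g l)

lemma measurable_MM {n : ℕ} {g : (Fin n → ℝ) → ℝ≥0∞} (hg : Measurable g) (l : List (Fin n)) :
    Measurable (MM g l) := by
  induction l with
  | nil => exact hg
  | cons i l ih => exact measurable_Mi _ _ ih

lemma MM_bound {n : ℕ} {p : ℝ} (hp : 1 < p) {w : (Fin n → ℝ) → ℝ} {W : (Fin n → ℝ) → ℝ≥0∞}
    (hW : Measurable W) (hpos : ∀ t, 0 < W t) (hfin : ∀ t, W t < ∞)
    (hu : ∀ᵐ x, ENNReal.ofReal (w x) = W x) (hA : ∀ i, apPlusVar p w i ≠ ∞)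
    (g : (Fin n → ℝ) → ℝ≥0∞) (hg : Measurable g) (l : List (Fin n)) :
    ∫⁻ x, (MM g l x) ^ p * W x ≤
      (l.map (fun i => Wt.Cp p * (apPlusVar p w i) ^ (p/(p-1)))).prod * ∫⁻ x, g x ^ p * W x := by
  induction l with
  | nil => simp [MM]
  | cons i l ih =>
    simp only [MM, List.map_cons, List.prod_cons]
    refine (step hp hW hpos hfin hu i (hA i) _ (measurable_MM hg l)).trans ?_
    rw [mul_assoc (Wt.Cp p * _)]
    exact mul_le_mul_right ih _

lemma lmarg {n : ℕ} {g : (Fin n → ℝ) → ℝ≥0∞} (hg : Measurable g) (x0 h : Fin n → ℝ)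
    (hh : ∀ i, 0 < h i) (l : List (Fin n)) (hl : l.Nodup) :
    ∀ x : Fin n → ℝ, (∀ j ∈ l, x j = x0 j) →
    (∫⋯∫⁻_l.toFinset, g ∂(fun i => (volume : Measure ℝ).restrict (Ioo (x0 i) (x0 i + h i)))) x ≤
      (l.map (fun i => ENNReal.ofReal (h i))).prod * MM g l x := by
  induction l with
  | nil => intro x _; simp [MM]
  | cons i l ih =>
    intro x hx
    have hil : i ∉ l := (List.nodup_cons.1 hl).1
    rw [List.toFinset_cons, lmarginal_insert _ hg (by simpa using hil)]
    simp only [List.map_cons, List.prod_cons, MM]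
    have hPt : (l.map (fun i => ENNReal.ofReal (h i))).prod ≠ ∞ := by
      clear ih hx hil hl
      induction l with
      | nil => simp
      | cons a l ih => simp only [List.map_cons, List.prod_cons]; exact ENNReal.mul_ne_top ENNReal.ofReal_ne_top ih
    calc _ ≤ ∫⁻ t in Ioo (x0 i) (x0 i + h i), (l.map (fun i => ENNReal.ofReal (h i))).prod *
            MM g l (Function.update x i t) := by
          refine lintegral_mono fun t => ?_
          refine ih (List.nodup_cons.1 hl).2 _ fun j hj => ?_
          rw [Function.update_of_ne (by rintro rfl; exact hil hj)]
          exact hx j (List.mem_cons_of_mem _ hj)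
      _ = (l.map (fun i => ENNReal.ofReal (h i))).prod * ∫⁻ t in Ioo (x0 i) (x0 i + h i),
            MM g l (Function.update x i t) := lintegral_const_mul' _ _ hPt
      _ ≤ (l.map (fun i => ENNReal.ofReal (h i))).prod * (Mi i (MM g l) x * ENNReal.ofReal (h i)) := by
          refine mul_le_mul_right ?_ _
          have := lint_le_Mx volume (fun t => MM g l (Function.update x i t))
            (show x0 i < x0 i + h i by linarith [hh i])
          rw [Real.volume_Ioo, add_sub_cancel_left] at this
          unfold Mi
          rwa [hx i (List.mem_cons_self)]
      _ = _ := by ring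

lemma box_le {n : ℕ} {g : (Fin n → ℝ) → ℝ≥0∞} (hg : Measurable g) (x h : Fin n → ℝ)
    (hh : ∀ i, 0 < h i) :
    ∫⁻ y in univ.pi (fun i => Ioo (x i) (x i + h i)), g y ≤
      (∏ i, ENNReal.ofReal (h i)) * MM g (Finset.univ : Finset (Fin n)).toList x := by
  have := lmarg hg x h hh (Finset.univ : Finset (Fin n)).toList (Finset.nodup_toList _) x
    (fun _ _ => rfl)
  rw [Finset.toList_toFinset, lmarginal_univ, ← Measure.restrict_pi_pi, Finset.prod_map_toList] at this
  exact this

lemma exists_meas {n : ℕ} (F : (Fin n → ℝ) → ℝ≥0∞) : ∃ g : (Fin n → ℝ) → ℝ≥0∞, Measurable g ∧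
    g ≤ F ∧ ∀ a b : Fin n → ℝ, ∫⁻ y in univ.pi (fun i => Ioo (a i) (b i)), F y ≤
      ∫⁻ y in univ.pi (fun i => Ioo (a i) (b i)), g y := by
  choose G hGm hGle hG using fun ab : (Fin n → ℚ) × (Fin n → ℚ) =>
    exists_measurable_le_lintegral_eq
      (volume.restrict (univ.pi (fun i => Ioo (ab.1 i : ℝ) (ab.2 i)))) F
  refine ⟨fun x => ⨆ ab, G ab x, Measurable.iSup hGm, fun x => iSup_le fun ab => hGle ab x, ?_⟩
  intro a b
  set J := {ab : (Fin n → ℚ) × (Fin n → ℚ) // ∀ i, a i ≤ ab.1 i ∧ (ab.2 i : ℝ) ≤ b i}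
  set s : J → Set (Fin n → ℝ) := fun ab => univ.pi (fun i => Ioo (ab.1.1 i : ℝ) (ab.1.2 i)) with hs
  have hd : Directed (fun x1 x2 => x1 ⊆ x2) s := by
    intro u v
    refine ⟨⟨(u.1.1 ⊓ v.1.1, u.1.2 ⊔ v.1.2), fun i => ⟨?_, ?_⟩⟩, ?_, ?_⟩
    · simp only [Pi.inf_apply, Rat.cast_min]; exact le_min (u.2 i).1 (v.2 i).1
    · simp only [Pi.sup_apply, Rat.cast_max]; exact max_le (u.2 i).2 (v.2 i).2
    · refine Set.pi_mono fun i _ => Ioo_subset_Ioo ?_ ?_ <;> simp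
    · refine Set.pi_mono fun i _ => Ioo_subset_Ioo ?_ ?_ <;> simp
  have hU : univ.pi (fun i => Ioo (a i) (b i)) = ⋃ j, s j := by
    ext x
    simp only [mem_iUnion, hs, mem_univ_pi]
    constructor
    · intro hx
      choose q hq1 hq2 using fun i => exists_rat_btwn (hx i).1
      choose r hr1 hr2 using fun i => exists_rat_btwn (hx i).2
      exact ⟨⟨(q, r), fun i => ⟨(hq1 i).le, (hr2 i).le⟩⟩, fun i => ⟨hq2 i, hr1 i⟩⟩
    · rintro ⟨j, hj⟩ i
      exact ⟨(j.2 i).1.trans_lt (hj i).1, (hj i).2.trans_le (j.2 i).2⟩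
  rw [hU, setLIntegral_iUnion_of_directed _ hd]
  refine iSup_le fun j => ?_
  calc ∫⁻ y in s j, F y = ∫⁻ y in s j, G j.1 y := hG j.1
    _ ≤ ∫⁻ y in s j, ⨆ ab, G ab y := lintegral_mono fun y => le_iSup (fun ab => G ab y) j.1
    _ ≤ _ := lintegral_mono_set (subset_iUnion s j)

lemma upper {n : ℕ} {p : ℝ} (hp : 1 < p) {w : (Fin n → ℝ) → ℝ} (hw : IsWeightN w)
    (hA : ∀ i, apPlusVar p w i ≠ ∞) (f : (Fin n → ℝ) → ℝ) :
    lnormWN p w (MsPlus f) ≤ ((Wt.Cp p) ^ n) ^ (1/p) * (∏ i, apPlusVar p w i) ^ (1 / (p - 1)) *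
              lnormWN p w (fun x => ENNReal.ofReal |f x|) := by
  have hp1 : 0 < p - 1 := by linarith
  have hp0 : 0 < p := by linarith
  obtain ⟨hw1, hw2⟩ := hw
  have hm : AEMeasurable (fun x => ENNReal.ofReal (w x)) volume :=
    hw2.aestronglyMeasurable.aemeasurable.ennreal_ofReal
  obtain ⟨V, hV, hwV⟩ := hm
  set W : (Fin n → ℝ) → ℝ≥0∞ := fun x => if 0 < V x ∧ V x < ∞ then V x else 1 with hWd
  have hWm : Measurable W := by
    refine Measurable.ite ?_ hV measurable_const
    exact (measurableSet_lt measurable_const hV).inter (measurableSet_lt hV measurable_const)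
  have hpos : ∀ t, 0 < W t := by
    intro t; simp only [hWd]; split_ifs with h
    · exact h.1
    · exact one_pos
  have hfin : ∀ t, W t < ∞ := by
    intro t; simp only [hWd]; split_ifs with h
    · exact h.2
    · exact ENNReal.one_lt_top
  have hu : ∀ᵐ x, ENNReal.ofReal (w x) = W x := by
    filter_upwards [hw1, hwV] with x h1 h2
    simp only [hWd]
    rw [if_pos, h2]
    rw [← h2]
    exact ⟨by simpa using h1, ENNReal.ofReal_lt_top⟩
  obtain ⟨g, hgm, hgle, hg⟩ := exists_meas (fun x => ENNReal.ofReal |f x|)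
  have hMs : ∀ x, MsPlus f x ≤ MM g (Finset.univ : Finset (Fin n)).toList x := by
    intro x
    unfold MsPlus
    refine iSup_le fun h => iSup_le fun hh => ?_
    have hP0 : (∏ i, ENNReal.ofReal (h i)) ≠ 0 := by
      rw [Finset.prod_ne_zero_iff]; intro i _; simpa using hh i
    have hPt : (∏ i, ENNReal.ofReal (h i)) ≠ ∞ := ENNReal.prod_ne_top fun i _ => ENNReal.ofReal_ne_top
    have e : ∫⁻ y in univ.pi (fun i => Ioc (x i) (x i + h i)), ENNReal.ofReal |f y| =
        ∫⁻ y in univ.pi (fun i => Ioo (x i) (x i + h i)), ENNReal.ofReal |f y| :=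
      setLIntegral_congr (Measure.pi_Ioo_ae_eq_pi_Ioc.symm)
    rw [e]
    calc _ ≤ (∏ i, ENNReal.ofReal (h i))⁻¹ * ((∏ i, ENNReal.ofReal (h i)) *
          MM g (Finset.univ : Finset (Fin n)).toList x) :=
          mul_le_mul_right ((hg _ _).trans (box_le hgm x h hh)) _
      _ = _ := by rw [← mul_assoc, ENNReal.inv_mul_cancel hP0 hPt, one_mul]
  have hmain : ∫⁻ x, MsPlus f x ^ p * ENNReal.ofReal (w x) ≤
      ((Wt.Cp p) ^ n * (∏ i, apPlusVar p w i) ^ (p/(p-1))) *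
        ∫⁻ x, ENNReal.ofReal |f x| ^ p * ENNReal.ofReal (w x) := by
    calc _ ≤ ∫⁻ x, (MM g (Finset.univ : Finset (Fin n)).toList x) ^ p * W x := by
          refine lintegral_mono_ae ?_
          filter_upwards [hu] with x hx
          rw [hx]
          exact mul_le_mul_left (ENNReal.rpow_le_rpow (hMs x) hp0.le) _
      _ ≤ _ := MM_bound hp hWm hpos hfin hu hA g hgm _
      _ ≤ _ := by
          rw [Finset.prod_map_toList, Finset.prod_mul_distrib, Finset.prod_const, Finset.card_univ,
            Fintype.card_fin, ENNReal.prod_rpow_of_nonneg (div_nonneg hp0.le hp1.le)]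
          refine mul_le_mul_right (lintegral_mono_ae ?_) _
          filter_upwards [hu] with x hx
          rw [hx]
          exact mul_le_mul_left (ENNReal.rpow_le_rpow (hgle x) hp0.le) _
  unfold lnormWN
  refine (ENNReal.rpow_le_rpow hmain (by positivity)).trans_eq ?_
  rw [ENNReal.mul_rpow_of_nonneg _ _ (by positivity), ENNReal.mul_rpow_of_nonneg _ _ (by positivity),
    ← ENNReal.rpow_mul]
  congr 3
  field_simp

end ND
end

noncomputable section
namespace Sh

lemma lint2 (μ : Fin 2 → Measure ℝ) [∀ i, SigmaFinite (μ i)] {a b : ℝ → ℝ≥0∞} (ha : Measurable a)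
    (hb : Measurable b) : ∫⁻ x, a (x 0) * b (x 1) ∂(Measure.pi μ) =
      (∫⁻ t, a t ∂(μ 0)) * ∫⁻ t, b t ∂(μ 1) := by
  have h := measurePreserving_piFinTwo μ
  rw [← lintegral_prod_mul ha.aemeasurable hb.aemeasurable]
  rw [← h.lintegral_comp_emb (MeasurableEquiv.measurableEmbedding _)]
  rfl

lemma I0 {ε : ℝ} (hε : 0 < ε) {L : ℝ} (hL : 0 ≤ L) :
    ∫⁻ t in Ioo 0 L, ENNReal.ofReal (|t| ^ (ε-1)) = ENNReal.ofReal (L ^ ε / ε) := by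
  have h1 : ∫ t in (0:ℝ)..L, t ^ (ε-1) = L ^ ε / ε := by
    rw [integral_rpow (Or.inl (by linarith))]
    simp [Real.zero_rpow hε.ne']
  have hi := intervalIntegral.intervalIntegrable_rpow' (a := 0) (b := L) (r := ε-1) (by linarith)
  rw [intervalIntegrable_iff_integrableOn_Ioo_of_le hL] at hi
  rw [← h1, intervalIntegral.integral_of_le hL, integral_Ioc_eq_integral_Ioo,
    ofReal_integral_eq_lintegral_ofReal hi]
  · refine setLIntegral_congr_fun measurableSet_Ioo fun t ht => ?_
    simp only [abs_of_pos ht.1]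
  · rw [EventuallyLE, ae_restrict_iff' measurableSet_Ioo]
    exact Eventually.of_forall fun t ht => Real.rpow_nonneg ht.1.le _

lemma I1 {ε : ℝ} (hε : 0 < ε) {L : ℝ} (hL : 0 ≤ L) :
    ∫⁻ t in Ioc 1 (1+L), ENNReal.ofReal (|1-t| ^ (ε-1)) = ENNReal.ofReal (L ^ ε / ε) := by
  rw [← I0 hε hL, setLIntegral_congr Ioo_ae_eq_Ioc.symm, ← lintegral_indicator measurableSet_Ioo,
    ← lintegral_indicator measurableSet_Ioo,
    ← lintegral_sub_right_eq_self ((Ioo 0 L).indicator _) (1:ℝ)]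
  congr 1; ext t
  simp only [indicator, mem_Ioo]
  rw [abs_sub_comm]
  have : (1 < t ∧ t < 1 + L) ↔ (0 < t - 1 ∧ t - 1 < L) := by constructor <;> rintro ⟨_, _⟩ <;> constructor <;> linarith
  simp only [this]

lemma I2 {ε : ℝ} (hε : 0 < ε) {L : ℝ} (hL : 0 ≤ L) :
    ∫⁻ t in Ioc (1-L) 1, ENNReal.ofReal (|1-t| ^ (ε-1)) = ENNReal.ofReal (L ^ ε / ε) := by
  rw [← I0 hε hL, setLIntegral_congr Ioo_ae_eq_Ioc.symm, ← lintegral_indicator measurableSet_Ioo,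
    ← lintegral_indicator measurableSet_Ioo,
    ← lintegral_sub_left_eq_self ((Ioo 0 L).indicator _) (1:ℝ)]
  congr 1; ext t
  simp only [indicator, mem_Ioo]
  have : (1 - L < t ∧ t < 1) ↔ (0 < 1 - t ∧ 1 - t < L) := by constructor <;> rintro ⟨_, _⟩ <;> constructor <;> linarith
  simp only [this]

lemma lint_const_mul (c : ℝ) (hc : 0 ≤ c) (v : ℝ → ℝ) (a b : ℝ) :
    avgIoc (fun t => c * v t) a b = ENNReal.ofReal c * avgIoc v a b := by
  unfold avgIoc lintIoc
  simp only [ENNReal.ofReal_mul hc]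
  rw [lintegral_const_mul' _ _ ENNReal.ofReal_ne_top]
  ring

lemma char_scale {p : ℝ} (hp : 1 < p) {c : ℝ} (hc : 0 < c) (u : ℝ → ℝ) (hu : ∀ t, 0 ≤ u t) :
    apPlusChar p (fun t => c * u t) = apPlusChar p u := by
  have hp1 : 0 < p - 1 := by linarith
  unfold apPlusChar
  refine iSup_congr fun x => iSup_congr fun h => iSup_congr fun hh => ?_
  have : (fun t => (c * u t) ^ (-(1/(p-1)))) = fun t => c ^ (-(1/(p-1))) * u t ^ (-(1/(p-1))) := by
    ext t; rw [Real.mul_rpow hc.le (hu t)]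
  rw [this, lint_const_mul c hc.le, lint_const_mul _ (Real.rpow_nonneg hc.le _),
    ENNReal.mul_rpow_of_nonneg _ _ hp1.le, ENNReal.ofReal_rpow_of_pos (Real.rpow_pos_of_pos hc _),
    ← Real.rpow_mul hc.le, mul_mul_mul_comm, ← ENNReal.ofReal_mul hc.le]
  have e : -(1/(p-1)) * (p-1) = -1 := by field_simp
  rw [e, Real.rpow_neg_one, mul_inv_cancel₀ hc.ne']
  simp

lemma avg_le {v : ℝ → ℝ} {a b B : ℝ} (hab : a < b) (h : ∀ t ∈ Ioc a b, v t ≤ B) :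
    avgIoc v a b ≤ ENNReal.ofReal B := by
  unfold avgIoc lintIoc
  calc _ ≤ (ENNReal.ofReal (b-a))⁻¹ * ∫⁻ t in Ioc a b, ENNReal.ofReal B := by
        refine mul_le_mul_right (setLIntegral_mono' measurableSet_Ioc fun t ht => ?_) _
        exact ENNReal.ofReal_le_ofReal (h t ht)
    _ = _ := by
        rw [setLIntegral_const, Real.volume_Ioc, mul_left_comm,
          ENNReal.inv_mul_cancel (by simpa using hab) ENNReal.ofReal_ne_top, mul_one]

lemma sg_eq {p ε : ℝ} (hp : 1 < p) (t : ℝ) :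
    (|1-t| ^ ((1-ε)*(p-1))) ^ (-(1/(p-1))) = |1-t| ^ (ε-1) := by
  have hp1 : p - 1 ≠ 0 := by linarith
  rw [← Real.rpow_mul (abs_nonneg _)]
  congr 1; field_simp; ring

lemma char_upper {p ε : ℝ} (hp : 1 < p) (h0 : 0 < ε) (h1 : ε < 1) :
    apPlusChar p (fun t => |1-t| ^ ((1-ε)*(p-1))) ≤ ENNReal.ofReal ((6/ε) ^ (p-1)) := by
  have hp1 : 0 < p - 1 := by linarith
  have hα : 0 < (1-ε)*(p-1) := mul_pos (by linarith) hp1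
  unfold apPlusChar
  simp only [sg_eq hp]
  refine iSup_le fun x => iSup_le fun h => iSup_le fun hh => ?_
  rcases le_or_gt (2*h) |1-x| with hd | hd
  · have hd0 : 0 < |1-x| := by linarith
    have a1 : avgIoc (fun t => |1-t| ^ ((1-ε)*(p-1))) (x-h) x ≤
        ENNReal.ofReal ((3/2*|1-x|) ^ ((1-ε)*(p-1))) := by
      refine avg_le (by linarith) fun t ht => Real.rpow_le_rpow (abs_nonneg _) ?_ hα.le
      have : |1-t| ≤ |1-x| + |x-t| := by
        have := abs_add_le (1-x) (x-t); simpa using this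
      have h2 : |x-t| ≤ h := by rw [abs_of_nonneg (by linarith [ht.2])]; linarith [ht.1]
      linarith
    have a2 : avgIoc (fun t => |1-t| ^ (ε-1)) x (x+h) ≤
        ENNReal.ofReal ((1/2*|1-x|) ^ (ε-1)) := by
      refine avg_le (by linarith) fun t ht => Real.rpow_le_rpow_of_nonpos (by positivity) ?_ (by linarith)
      have : |1-x| ≤ |1-t| + |t-x| := by
        have := abs_add_le (1-t) (t-x); simpa using this
      have h2 : |t-x| ≤ h := by rw [abs_of_nonneg (by linarith [ht.1])]; linarith [ht.2]
      linarith
    calc _ ≤ ENNReal.ofReal ((3/2*|1-x|) ^ ((1-ε)*(p-1))) * ENNReal.ofReal ((1/2*|1-x|) ^ (ε-1)) ^ (p-1) := by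
          gcongr
      _ = ENNReal.ofReal (3 ^ ((1-ε)*(p-1))) := by
          rw [ENNReal.ofReal_rpow_of_pos (by positivity), ← ENNReal.ofReal_mul (by positivity),
            ← Real.rpow_mul (by positivity)]
          have e : (ε-1)*(p-1) = -((1-ε)*(p-1)) := by ring
          rw [e, Real.rpow_neg (by positivity), ← Real.inv_rpow (by positivity),
            ← Real.mul_rpow (by positivity) (by positivity)]
          congr 2; field_simp
      _ ≤ _ := by
          apply ENNReal.ofReal_le_ofReal
          calc (3:ℝ) ^ ((1-ε)*(p-1)) ≤ 3 ^ (p-1) := by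
                apply Real.rpow_le_rpow_of_exponent_le (by norm_num); nlinarith
            _ ≤ _ := by
                apply Real.rpow_le_rpow (by norm_num) _ hp1.le
                rw [le_div_iff₀ h0]; linarith
  · have a1 : avgIoc (fun t => |1-t| ^ ((1-ε)*(p-1))) (x-h) x ≤
        ENNReal.ofReal ((3*h) ^ ((1-ε)*(p-1))) := by
      refine avg_le (by linarith) fun t ht => Real.rpow_le_rpow (abs_nonneg _) ?_ hα.le
      have : |1-t| ≤ |1-x| + |x-t| := by
        have := abs_add_le (1-x) (x-t); simpa using this
      have h2 : |x-t| ≤ h := by rw [abs_of_nonneg (by linarith [ht.2])]; linarith [ht.1]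
      linarith
    have hx := abs_lt.1 hd
    have a2 : avgIoc (fun t => |1-t| ^ (ε-1)) x (x+h) ≤ ENNReal.ofReal (6/ε * (3*h) ^ (ε-1)) := by
      unfold avgIoc lintIoc
      calc _ ≤ (ENNReal.ofReal (x+h-x))⁻¹ * (ENNReal.ofReal ((3*h)^ε/ε) + ENNReal.ofReal ((3*h)^ε/ε)) := by
            refine mul_le_mul_right ?_ _
            have j1 := I1 h0 (show 0 ≤ 3*h by positivity)
            have j2 := I2 h0 (show 0 ≤ 3*h by positivity)
            refine le_trans ?_ (add_le_add j2.le j1.le)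
            refine le_trans ?_ (lintegral_union_le _ _ _)
            refine lintegral_mono_set fun t ht => ?_
            rcases le_or_gt t 1 with h' | h'
            · left; exact ⟨by linarith [ht.1], h'⟩
            · right; exact ⟨h', by linarith [ht.2]⟩
        _ = _ := by
            rw [add_sub_cancel_left, ← ENNReal.ofReal_inv_of_pos hh, ← ENNReal.ofReal_add (by positivity) (by positivity),
              ← ENNReal.ofReal_mul (by positivity)]
            congr 1
            rw [Real.rpow_sub_one (by positivity)]
            field_simp; norm_num
    calc _ ≤ ENNReal.ofReal ((3*h) ^ ((1-ε)*(p-1))) * ENNReal.ofReal (6/ε * (3*h) ^ (ε-1)) ^ (p-1) := by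
          gcongr
      _ = _ := by
          rw [ENNReal.ofReal_rpow_of_pos (by positivity), ← ENNReal.ofReal_mul (by positivity),
            Real.mul_rpow (x := 6/ε) (by positivity) (by positivity),
            ← Real.rpow_mul (by positivity), mul_left_comm, ← Real.rpow_add (by positivity)]
          have e : (1-ε)*(p-1) + (ε-1)*(p-1) = 0 := by ring
          rw [e]; simp

lemma char_lower {p ε : ℝ} (hp : 1 < p) (h0 : 0 < ε) (h1 : ε < 1) :
    ENNReal.ofReal ((1/2) ^ p * (1/ε) ^ (p-1)) ≤ apPlusChar p (fun t => |1-t| ^ ((1-ε)*(p-1))) := by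
  have hp1 : 0 < p - 1 := by linarith
  have hα : 0 < (1-ε)*(p-1) := mul_pos (by linarith) hp1
  unfold apPlusChar
  simp only [sg_eq hp]
  refine le_iSup_of_le 1 (le_iSup_of_le 1 (le_iSup_of_le one_pos ?_))
  have a2 : avgIoc (fun t => |1-t| ^ (ε-1)) 1 (1+1) = ENNReal.ofReal (1/ε) := by
    unfold avgIoc lintIoc
    rw [I1 h0 (by norm_num)]; simp
  have a1 : ENNReal.ofReal ((1/2)^p) ≤ avgIoc (fun t => |1-t| ^ ((1-ε)*(p-1))) (1-1) 1 := by
    unfold avgIoc lintIoc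
    calc ENNReal.ofReal ((1/2)^p) = ∫⁻ t in Ioc (0:ℝ) (1/2), ENNReal.ofReal ((1/2)^(p-1)) := by
          rw [setLIntegral_const, Real.volume_Ioc, ← ENNReal.ofReal_mul (by positivity), sub_zero,
            Real.rpow_sub_one (by norm_num)]
          congr 1; field_simp
      _ ≤ ∫⁻ t in Ioc (0:ℝ) (1/2), ENNReal.ofReal (|1-t| ^ ((1-ε)*(p-1))) := by
          refine setLIntegral_mono' measurableSet_Ioc fun t ht => ENNReal.ofReal_le_ofReal ?_
          calc ((1:ℝ)/2)^(p-1) ≤ (1/2) ^ ((1-ε)*(p-1)) := by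
                apply Real.rpow_le_rpow_of_exponent_ge (by norm_num) (by norm_num); nlinarith
            _ ≤ _ := by
                apply Real.rpow_le_rpow (by norm_num) _ hα.le
                rw [abs_of_nonneg (by linarith [ht.2])]; linarith [ht.2]
      _ ≤ ∫⁻ t in Ioc (0:ℝ) 1, ENNReal.ofReal (|1-t| ^ ((1-ε)*(p-1))) :=
          lintegral_mono_set (Ioc_subset_Ioc_right (by norm_num))
      _ = _ := by simp
  rw [a2, ENNReal.ofReal_rpow_of_pos (by positivity), ENNReal.ofReal_mul (by positivity)]
  exact mul_le_mul_left a1 _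

lemma var_eq {p ε : ℝ} (hp : 1 < p) (h1 : ε < 1) (i : Fin 2) :
    apPlusVar p (fun x : Fin 2 → ℝ => |1 - x 0| ^ ((1 - ε) * (p - 1)) * |1 - x 1| ^ ((1 - ε) * (p - 1))) i
      = apPlusChar p (fun t => |1-t| ^ ((1-ε)*(p-1))) := by
  unfold apPlusVar
  have hne : (volume : Measure (Fin 2 → ℝ)) ≠ 0 := NeZero.ne _
  rw [← essSup_const (μ := (volume : Measure (Fin 2 → ℝ))) (apPlusChar p (fun t => |1-t| ^ ((1-ε)*(p-1)))) hne]
  apply essSup_congr_ae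
  have hh : ∀ j : Fin 2, ∀ᵐ x : Fin 2 → ℝ, x j ≠ 1 := fun j =>
    Measure.ae_eval_ne (fun _ : Fin 2 => (volume : Measure ℝ)) j 1
  filter_upwards [hh 0, hh 1] with x hx0 hx1
  have q0 : 0 < |1 - x 0| ^ ((1 - ε) * (p - 1)) :=
    Real.rpow_pos_of_pos (abs_pos.2 (sub_ne_zero.2 hx0.symm)) _
  have q1 : 0 < |1 - x 1| ^ ((1 - ε) * (p - 1)) :=
    Real.rpow_pos_of_pos (abs_pos.2 (sub_ne_zero.2 hx1.symm)) _
  fin_cases i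
  · simp only [Fin.zero_eta, Function.update_self, ne_eq, one_ne_zero, not_false_eq_true, Function.update_of_ne]
    rw [← char_scale hp q1 _ fun t => Real.rpow_nonneg (abs_nonneg _) _]
    congr 1; ext t; exact mul_comm _ _
  · simp only [Fin.mk_one, Function.update_self, ne_eq, zero_ne_one, not_false_eq_true, Function.update_of_ne]
    exact char_scale hp q0 _ fun t => Real.rpow_nonneg (abs_nonneg _) _

def f1 (ε : ℝ) : ℝ → ℝ := (Ioo (0:ℝ) 1).indicator (fun t => |1-t| ^ (ε-1))

lemma f1_meas (ε : ℝ) : Measurable (f1 ε) := by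
  unfold f1
  refine Measurable.indicator ?_ measurableSet_Ioo
  fun_prop

lemma f1_nonneg (ε t : ℝ) : 0 ≤ f1 ε t := indicator_nonneg (fun _ _ => Real.rpow_nonneg (abs_nonneg _) _) _

lemma f1_int {ε : ℝ} (h0 : 0 < ε) {x : ℝ} (hx : x ∈ Ioo (0:ℝ) 1) :
    ∫⁻ t in Ioc x 1, ENNReal.ofReal (f1 ε t) = ENNReal.ofReal ((1-x) ^ ε / ε) := by
  rw [← I2 h0 (by linarith [hx.2]), sub_sub_cancel, setLIntegral_congr Ioo_ae_eq_Ioc.symm,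
    setLIntegral_congr Ioo_ae_eq_Ioc.symm]
  refine setLIntegral_congr_fun measurableSet_Ioo fun t ht => ?_
  simp only [f1]
  rw [indicator_of_mem (show t ∈ Ioo (0:ℝ) 1 from ⟨hx.1.trans ht.1, ht.2⟩)]

lemma Ms_lower {ε : ℝ} (h0 : 0 < ε) (x : Fin 2 → ℝ) :
    ENNReal.ofReal (1/ε^2) * ENNReal.ofReal |f1 ε (x 0) * f1 ε (x 1)| ≤
      MsPlus (fun x : Fin 2 → ℝ => f1 ε (x 0) * f1 ε (x 1)) x := by
  by_cases hx : x 0 ∈ Ioo (0:ℝ) 1 ∧ x 1 ∈ Ioo (0:ℝ) 1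
  swap
  · have : f1 ε (x 0) * f1 ε (x 1) = 0 := by
      rw [not_and_or] at hx
      rcases hx with hx | hx <;> simp [f1, indicator_of_notMem hx]
    rw [this]; simp
  obtain ⟨hx0, hx1⟩ := hx
  have p0 : 0 < 1 - x 0 := by linarith [hx0.2]
  have p1 : 0 < 1 - x 1 := by linarith [hx1.2]
  unfold MsPlus
  refine le_iSup_of_le (fun i => 1 - x i) (le_iSup_of_le ?_ ?_)
  · intro i; fin_cases i
    · exact p0
    · exact p1
  simp only [add_sub_cancel, Fin.prod_univ_two]
  have e : ∫⁻ y in univ.pi (fun i => Ioc (x i) 1), ENNReal.ofReal |f1 ε (y 0) * f1 ε (y 1)| =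
      ENNReal.ofReal ((1-x 0) ^ ε / ε) * ENNReal.ofReal ((1-x 1) ^ ε / ε) := by
    rw [← f1_int h0 hx0, ← f1_int h0 hx1]
    have := lint2 (fun i => (volume : Measure ℝ).restrict (Ioc (x i) 1))
      (f1_meas ε).ennreal_ofReal (f1_meas ε).ennreal_ofReal
    rw [← this, ← Measure.restrict_pi_pi]
    simp only [abs_of_nonneg (mul_nonneg (f1_nonneg ε _) (f1_nonneg ε _)), ENNReal.ofReal_mul (f1_nonneg ε _)]
    rfl
  rw [e, abs_of_nonneg (mul_nonneg (f1_nonneg ε _) (f1_nonneg ε _)), ← ENNReal.ofReal_mul (by positivity),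
    ← ENNReal.ofReal_mul (by positivity), ← ENNReal.ofReal_mul (by positivity),
    ← ENNReal.ofReal_inv_of_pos (by positivity), ← ENNReal.ofReal_mul (by positivity)]
  apply ENNReal.ofReal_le_ofReal
  simp only [f1]
  rw [indicator_of_mem hx0, indicator_of_mem hx1, abs_of_pos p0, abs_of_pos p1,
    Real.rpow_sub_one p0.ne', Real.rpow_sub_one p1.ne']
  apply le_of_eq
  field_simp

lemma f_norm {p ε : ℝ} (hp : 1 < p) (h0 : 0 < ε) :
    ∫⁻ x : Fin 2 → ℝ, ENNReal.ofReal |f1 ε (x 0) * f1 ε (x 1)| ^ p *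
      ENNReal.ofReal (|1 - x 0| ^ ((1 - ε) * (p - 1)) * |1 - x 1| ^ ((1 - ε) * (p - 1))) =
      ENNReal.ofReal (1/ε) * ENNReal.ofReal (1/ε) := by
  have hp0 : 0 < p := by linarith
  have hp1 : 0 < p - 1 := by linarith
  have m : Measurable (fun t : ℝ => ENNReal.ofReal (f1 ε t ^ p * |1-t| ^ ((1 - ε) * (p - 1)))) := by
    have := f1_meas ε
    fun_prop
  have e : ∫⁻ t, ENNReal.ofReal (f1 ε t ^ p * |1-t| ^ ((1 - ε) * (p - 1))) = ENNReal.ofReal (1/ε) := by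
    have h := I2 h0 (zero_le_one)
    rw [Real.one_rpow, sub_self] at h
    rw [← h, setLIntegral_congr Ioo_ae_eq_Ioc.symm, ← lintegral_indicator measurableSet_Ioo]
    congr 1; ext t
    by_cases ht : t ∈ Ioo (0:ℝ) 1
    · have : 0 < |1-t| := abs_pos.2 (by linarith [ht.2])
      simp only [f1, indicator_of_mem ht]
      rw [← Real.rpow_mul this.le, ← Real.rpow_add this]
      congr 2; ring
    · simp only [f1, indicator_of_notMem ht]
      rw [Real.zero_rpow hp0.ne']; simp
  have := lint2 (fun _ => (volume : Measure ℝ)) m m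
  rw [e] at this
  rw [← this]
  refine lintegral_congr fun x => ?_
  have a0 := f1_nonneg ε (x 0)
  have a1 := f1_nonneg ε (x 1)
  rw [abs_of_nonneg (mul_nonneg a0 a1), ENNReal.ofReal_rpow_of_nonneg (mul_nonneg a0 a1) hp0.le,
    ← ENNReal.ofReal_mul (by positivity), ← ENNReal.ofReal_mul (by positivity), Real.mul_rpow a0 a1]
  congr 1; ring

lemma sharp (p : ℝ) (hp : 1 < p) : (∃ c₁ c₂ c₃ : ℝ, 0 < c₁ ∧ 0 < c₂ ∧ 0 < c₃ ∧
      ∀ ε : ℝ, ε ∈ Set.Ioo (0 : ℝ) 1 →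
        let w : (Fin 2 → ℝ) → ℝ := fun x =>
          |1 - x 0| ^ ((1 - ε) * (p - 1)) * |1 - x 1| ^ ((1 - ε) * (p - 1))
        ENNReal.ofReal (c₁ / ε ^ 2) ≤
            (apPlusVar p w 0 * apPlusVar p w 1) ^ (1 / (p - 1)) ∧
        (apPlusVar p w 0 * apPlusVar p w 1) ^ (1 / (p - 1)) ≤
            ENNReal.ofReal (c₂ / ε ^ 2) ∧
        ∃ f : (Fin 2 → ℝ) → ℝ,
          lnormWN p w (fun x => ENNReal.ofReal |f x|) ≠ 0 ∧
          lnormWN p w (fun x => ENNReal.ofReal |f x|) ≠ ∞ ∧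
          ENNReal.ofReal (c₃ / ε ^ 2) * lnormWN p w (fun x => ENNReal.ofReal |f x|) ≤
            lnormWN p w (MsPlus f)) := by
  have hp1 : 0 < p - 1 := by linarith
  have hp0 : 0 < p := by linarith
  refine ⟨((1/2)^p) ^ (1/(p-1)) * ((1/2)^p) ^ (1/(p-1)), 36, 1, by positivity, by norm_num, one_pos, ?_⟩
  rintro ε ⟨h0, h1⟩
  intro w
  have v0 : apPlusVar p w 0 = _ := var_eq hp h1 0
  have v1 : apPlusVar p w 1 = _ := var_eq hp h1 1
  have hup := char_upper hp h0 h1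
  have hlo := char_lower hp h0 h1
  rw [v0, v1]
  set A := apPlusChar p (fun t => |1-t| ^ ((1-ε)*(p-1)))
  have hinv : (p-1) * (1/(p-1)) = 1 := by field_simp
  refine ⟨?_, ?_, fun x => f1 ε (x 0) * f1 ε (x 1), ?_⟩
  · have : ENNReal.ofReal (((1/2)^p) ^ (1/(p-1)) * (1/ε)) ≤ A ^ (1/(p-1)) := by
      refine le_trans (le_of_eq ?_) (ENNReal.rpow_le_rpow hlo (by positivity))
      rw [ENNReal.ofReal_rpow_of_pos (by positivity), Real.mul_rpow (by positivity) (by positivity),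
        ← Real.rpow_mul (x := 1/ε) (by positivity), hinv, Real.rpow_one]
    rw [ENNReal.mul_rpow_of_nonneg _ _ (by positivity)]
    refine le_trans (le_of_eq ?_) (mul_le_mul' this this)
    rw [← ENNReal.ofReal_mul (by positivity)]
    congr 1; field_simp
  · have : A ^ (1/(p-1)) ≤ ENNReal.ofReal (6/ε) := by
      refine (ENNReal.rpow_le_rpow hup (by positivity)).trans (le_of_eq ?_)
      rw [ENNReal.ofReal_rpow_of_pos (by positivity), ← Real.rpow_mul (by positivity), hinv, Real.rpow_one]
    rw [ENNReal.mul_rpow_of_nonneg _ _ (by positivity)]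
    refine (mul_le_mul' this this).trans (le_of_eq ?_)
    rw [← ENNReal.ofReal_mul (by positivity)]
    congr 1; field_simp; norm_num
  · have hN : lnormWN p w (fun x => ENNReal.ofReal |f1 ε (x 0) * f1 ε (x 1)|) =
        (ENNReal.ofReal (1/ε) * ENNReal.ofReal (1/ε)) ^ (1/p) := by
      unfold lnormWN
      rw [← f_norm hp h0]
    have hε : 0 < 1/ε := by positivity
    have hne0 : ENNReal.ofReal (1/ε) * ENNReal.ofReal (1/ε) ≠ 0 := by
      rw [← ENNReal.ofReal_mul hε.le]; rw [ENNReal.ofReal_ne_zero_iff]; positivity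
    have hnet : ENNReal.ofReal (1/ε) * ENNReal.ofReal (1/ε) ≠ ∞ :=
      ENNReal.mul_ne_top ENNReal.ofReal_ne_top ENNReal.ofReal_ne_top
    refine ⟨?_, ?_, ?_⟩
    · rw [hN]; exact (ENNReal.rpow_pos (pos_iff_ne_zero.2 hne0) hnet).ne'
    · rw [hN]; exact ENNReal.rpow_ne_top_of_nonneg (by positivity) hnet
    · unfold lnormWN
      set c := ENNReal.ofReal (1/ε^2) with hc
      have hcp : c = (c ^ p) ^ (1/p) := by
        rw [← ENNReal.rpow_mul, mul_one_div_cancel hp0.ne', ENNReal.rpow_one]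
      nth_rewrite 1 [hcp]
      rw [← ENNReal.mul_rpow_of_nonneg _ _ (by positivity)]
      refine ENNReal.rpow_le_rpow ?_ (by positivity)
      rw [← lintegral_const_mul' _ _ (ENNReal.rpow_ne_top_of_nonneg hp0.le ENNReal.ofReal_ne_top)]
      refine lintegral_mono fun x => ?_
      rw [← mul_assoc, ← ENNReal.mul_rpow_of_nonneg _ _ hp0.le]
      exact mul_le_mul_left (ENNReal.rpow_le_rpow (Ms_lower h0 x) hp0.le) _

end Sh
end

/-- Sharp mixed bound for the one-sided strong maximal operator:
`‖M^{+(s)}f‖_{L^p_w} ≤ c (∏ᵢ ‖w‖_{A_p^+(x_i)})^{1/(p-1)} ‖f‖_{L^p_w}` when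
`w ∈ A_p^{+(s)}(ℝⁿ)` (i.e. `w ∈ A_p^+(x_i)` for all `i`), and the power `1/(p-1)`
is sharp: for `n = 2`, `w(x₁,x₂) = |1-x₁|^{(1-ε)(p-1)}|1-x₂|^{(1-ε)(p-1)}` has
`(‖w‖_{A_p^+(x_1)}‖w‖_{A_p^+(x_2)})^{1/(p-1)} ≍ ε⁻²` and some `f ∈ L^p_w` has
`‖M^{+(s)}f‖_{L^p_w} ≥ c ε⁻² ‖f‖_{L^p_w}`. -/
theorem stmt19 (n : ℕ) (hn : 0 < n) (p : ℝ) (hp : 1 < p) :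
    (∃ c : ℝ, 0 < c ∧
      ∀ w : (Fin n → ℝ) → ℝ, IsWeightN w → (∀ i, apPlusVar p w i ≠ ∞) →
        ∀ f : (Fin n → ℝ) → ℝ,
          lnormWN p w (MsPlus f) ≤
            ENNReal.ofReal c * (∏ i, apPlusVar p w i) ^ (1 / (p - 1)) *
              lnormWN p w (fun x => ENNReal.ofReal |f x|)) ∧
    (∃ c₁ c₂ c₃ : ℝ, 0 < c₁ ∧ 0 < c₂ ∧ 0 < c₃ ∧
      ∀ ε : ℝ, ε ∈ Set.Ioo (0 : ℝ) 1 →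
        let w : (Fin 2 → ℝ) → ℝ := fun x =>
          |1 - x 0| ^ ((1 - ε) * (p - 1)) * |1 - x 1| ^ ((1 - ε) * (p - 1))
        ENNReal.ofReal (c₁ / ε ^ 2) ≤
            (apPlusVar p w 0 * apPlusVar p w 1) ^ (1 / (p - 1)) ∧
        (apPlusVar p w 0 * apPlusVar p w 1) ^ (1 / (p - 1)) ≤
            ENNReal.ofReal (c₂ / ε ^ 2) ∧
        ∃ f : (Fin 2 → ℝ) → ℝ,
          lnormWN p w (fun x => ENNReal.ofReal |f x|) ≠ 0 ∧
          lnormWN p w (fun x => ENNReal.ofReal |f x|) ≠ ∞ ∧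
          ENNReal.ofReal (c₃ / ε ^ 2) * lnormWN p w (fun x => ENNReal.ofReal |f x|) ≤
            lnormWN p w (MsPlus f)) := by
  refine ⟨?_, Sh.sharp p hp⟩
  have hC : ((Wt.Cp p) ^ n) ^ (1/p) ≠ ∞ :=
    ENNReal.rpow_ne_top_of_nonneg (by positivity) (ENNReal.pow_ne_top (Wt.Cp_ne_top hp))
  refine ⟨(((Wt.Cp p) ^ n) ^ (1/p)).toReal + 1, by positivity, fun w hw hA f => ?_⟩
  refine (ND.upper hp hw hA f).trans ?_
  gcongr
  rw [ENNReal.le_ofReal_iff_toReal_le hC (by positivity)]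
  linarith

end
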